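/- Let (R, m, k) be a Noetherian local ring of characteristic 2 and Krull dimension d, and let M be a nonzero R-module of finite length and finite projective dimension. Then the total Betti number β(M) = ∑_i dim_k Tor_i^R(M, k) is at least 2^d. -/

import Mathlib

open CategoryTheory

/-- The base change of a chain complex of `R`-modules to the residue field `k` of a local
ring `R`; for a free resolution `P` of `M`, the `k`-dimension of `H_i` of this complex is
the Betti number `β_i(M) = dim_k Tor_i^R(M, k)`. -/
noncomputable def residueComplex (R : Type) [CommRing R] [IsLocalRing R]
    (P : ChainComplex (ModuleCat R) ℕ) :
    ChainComplex (ModuleCat (IsLocalRing.ResidueField R)) ℕ :=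
  ((ModuleCat.extendScalars (IsLocalRing.residue R)).mapHomologicalComplex _).obj P

section TensorSquare

variable {R ι : Type*} [CommRing R]

/-- `D` lowers the degree by exactly one. -/
def LowersDegree (deg : ι → ℕ) (D : Matrix ι ι R) : Prop :=
  ∀ i j, D i j ≠ 0 → deg j = deg i + 1

variable {deg : ι → ℕ} {D : Matrix ι ι R}

theorem LowersDegree.eq_zero (hdeg : LowersDegree deg D) {i j : ι} (h : deg j ≠ deg i + 1) :
    D i j = 0 := by
  by_contra h'
  exact h (hdeg i j h')

theorem LowersDegree.map (hdeg : LowersDegree deg D) {n : ℕ} (hn : n ≠ 0) :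
    LowersDegree deg (D.map (· ^ n)) := fun i j h =>
  hdeg i j fun h' => h (by simp [h', hn])

variable [Fintype ι]

/-- The differential module `(ι → R, D)` has no homology in positive degrees. -/
def AcyclicPos (deg : ι → ℕ) (D : Matrix ι ι R) : Prop :=
  ∀ x : ι → R, D.mulVec x = 0 → (∀ i, deg i = 0 → x i = 0) → ∃ y, D.mulVec y = x

/-- The differential on matrices, viewed as elements of `F ⊗ F` for the differential module
`F = (ι → R, D)`, perturbed by `1 + σ` where `σ` swaps the two factors. -/
def tateDiff (D : Matrix ι ι R) : Matrix ι ι R →ₗ[R] Matrix ι ι R where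
  toFun t := D * t + t * D.transpose + t + t.transpose
  map_add' s t := by
    rw [Matrix.mul_add, Matrix.add_mul, Matrix.transpose_add]; abel
  map_smul' r t := by
    simp [smul_add]

theorem tateDiff_apply (D t : Matrix ι ι R) :
    tateDiff D t = D * t + t * D.transpose + t + t.transpose := rfl

theorem tateDiff_apply_apply (D t : Matrix ι ι R) (i j : ι) :
    tateDiff D t i j = ∑ l, D i l * t l j + ∑ l, t i l * D j l + t i j + t j i := rfl

theorem tateDiff_sandwich [CharP R 2] {D : Matrix ι ι R} (hD : D * D = 0) {s : Matrix ι ι R}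
    (hs : s.transpose = s) : tateDiff D (s + D * s) = D * s * D.transpose := by
  have h2 : ∀ x : Matrix ι ι R, x + x = 0 := fun x => by ext; exact CharTwo.add_self_eq_zero _
  have e : D * (D * s) = 0 := by rw [← Matrix.mul_assoc, hD, Matrix.zero_mul]
  rw [tateDiff_apply, Matrix.mul_add, e, Matrix.add_mul, Matrix.transpose_add,
    Matrix.transpose_mul, hs]
  have : D * s + 0 + (s * D.transpose + D * s * D.transpose) + (s + D * s)
      + (s + s * D.transpose) = (D * s + D * s) + (s * D.transpose + s * D.transpose) + (s + s)
      + D * s * D.transpose := by abel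
  simp only [this, h2, zero_add]

theorem tateDiff_tateDiff [CharP R 2] {D : Matrix ι ι R} (hD : D * D = 0) (t : Matrix ι ι R) :
    tateDiff D (tateDiff D t) = 0 := by
  have h2 : ∀ x : Matrix ι ι R, x + x = 0 := fun x => by ext; exact CharTwo.add_self_eq_zero _
  have e (s : Matrix ι ι R) : D * (D * s) = 0 := by rw [← Matrix.mul_assoc, hD, Matrix.zero_mul]
  have e' (s : Matrix ι ι R) : s * D.transpose * D.transpose = 0 := by
    rw [Matrix.mul_assoc, ← Matrix.transpose_mul, hD]; simp
  simp only [tateDiff_apply, Matrix.mul_add, Matrix.add_mul, Matrix.transpose_add,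
    Matrix.transpose_mul, Matrix.transpose_transpose, e, e', ← Matrix.mul_assoc]
  generalize D * t * D.transpose = a
  generalize D * t = b
  generalize D * t.transpose = c
  generalize t * D.transpose = d
  generalize t.transpose * D.transpose = f
  generalize t.transpose = g
  calc _ = (a + a) + (b + b) + (c + c) + (d + d) + (f + f) + (t + t) + (g + g) := by abel
    _ = 0 := by simp only [h2]

theorem LowersDegree.sum_left_eq_zero (hdeg : LowersDegree deg D) {i : ι} {v : ι → R}
    (h : ∀ l, deg l = deg i + 1 → v l = 0) : ∑ l, D i l * v l = 0 :=
  Finset.sum_eq_zero fun l _ => by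
    by_cases hl : deg l = deg i + 1
    · rw [h l hl, mul_zero]
    · rw [hdeg.eq_zero hl, zero_mul]

theorem LowersDegree.sum_right_eq_zero (hdeg : LowersDegree deg D) {i : ι} {v : ι → R}
    (h : ∀ l, deg l = deg i + 1 → v l = 0) : ∑ l, v l * D i l = 0 := by
  simpa only [mul_comm] using hdeg.sum_left_eq_zero h

theorem LowersDegree.tateDiff_apply_top (hdeg : LowersDegree deg D) {t : Matrix ι ι R} {n : ℕ}
    (ht : ∀ i j, n < deg i + deg j → t i j = 0) {i j : ι} (h : n ≤ deg i + deg j) :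
    tateDiff D t i j = t i j + t j i := by
  rw [tateDiff_apply_apply, hdeg.sum_left_eq_zero (fun l hl => ht l j (by omega)),
    hdeg.sum_right_eq_zero (fun l hl => ht i l (by omega))]
  simp

/-- A symmetric top component with vanishing diagonal is a norm, hence can be removed. -/
theorem LowersDegree.exists_sub_tateDiff [CharP R 2] (hdeg : LowersDegree deg D)
    {t : Matrix ι ι R} {n : ℕ}
    (ht : ∀ i j, n < deg i + deg j → t i j = 0)
    (hsymm : ∀ i j, deg i + deg j = n → t i j + t j i = 0)
    (hdiag : ∀ i, 2 * deg i = n → t i i = 0) :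
    ∃ y, ∀ i j, n ≤ deg i + deg j → (t - tateDiff D y) i j = 0 := by
  classical
  let e := Fintype.equivFin ι
  let y : Matrix ι ι R := fun i j => if deg i + deg j = n ∧ e i < e j then t i j else 0
  have hy : ∀ i j, n < deg i + deg j → y i j = 0 := fun i j h => if_neg (by omega)
  refine ⟨y, fun i j h => ?_⟩
  rw [Matrix.sub_apply, hdeg.tateDiff_apply_top hy h]
  rcases h.eq_or_lt with h | h
  · rcases lt_trichotomy (e i) (e j) with hij | hij | hij
    · simp [y, ← h, hij, hij.le]
    · have : i = j := e.injective hij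
      subst this
      simp [y, hdiag i (by omega)]
    · have h1 := hsymm i j h.symm
      have h2 : t i j = t j i := by
        rw [← CharTwo.neg_eq (t j i)]; exact eq_neg_of_add_eq_zero_left h1
      simp [y, add_comm (deg j), ← h, hij, hij.le, h2]
  · rw [ht i j h, hy i j h, hy j i (by omega)]; simp

theorem sandwich_diagonal_apply_self [DecidableEq ι] (D : Matrix ι ι R) (z : ι → R) (i : ι) :
    (D * Matrix.diagonal z * D.transpose) i i = (D.map (· ^ 2)).mulVec z i := by
  rw [Matrix.mul_apply]
  simp only [Matrix.mul_diagonal, Matrix.transpose_apply, Matrix.mulVec, dotProduct,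
    Matrix.map_apply]
  exact Finset.sum_congr rfl fun l _ => by ring

theorem LowersDegree.sandwich_apply_eq_zero [DecidableEq ι] (hdeg : LowersDegree deg D)
    {z : ι → R} {p : ℕ}
    (hz : ∀ i, deg i ≠ p → z i = 0) {i j : ι} (h : deg i + deg j + 2 ≠ 2 * p) :
    (D * Matrix.diagonal z * D.transpose) i j = 0 := by
  rw [Matrix.mul_apply]
  simp only [Matrix.mul_diagonal, Matrix.transpose_apply]
  refine Finset.sum_eq_zero fun l _ => ?_
  by_cases h1 : deg l = deg i + 1
  · by_cases h2 : deg l = deg j + 1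
    · rw [hz l (by omega)]; simp
    · rw [hdeg.eq_zero h2]; simp
  · rw [hdeg.eq_zero h1]; simp

theorem LowersDegree.mulVec_restrict [DecidableEq ι] (hdeg : LowersDegree deg D) (y : ι → R)
    (p : ℕ) (i : ι) :
    D.mulVec (fun l => if deg l = p + 1 then y l else 0) i
      = if deg i = p then D.mulVec y i else 0 := by
  split_ifs with h
  · refine Finset.sum_congr rfl fun l _ => ?_
    by_cases hl : deg l = deg i + 1
    · simp [hl, h]
    · change D i l * _ = D i l * _
      rw [hdeg.eq_zero hl, zero_mul, zero_mul]
  · refine hdeg.sum_left_eq_zero fun l hl => if_neg (by omega)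

theorem diag_tateDiff_mem [CharP R 2] (hdeg : LowersDegree deg D) (hD : D * D = 0)
    (hac : AcyclicPos deg (D.map (· ^ 2))) (n : ℕ) :
    ∀ t : Matrix ι ι R, (∀ i j, n ≤ deg i + deg j → t i j = 0) →
      (∀ i j, 0 < deg i + deg j → tateDiff D t i j = 0) →
      ∃ z, ∀ i, deg i = 0 → tateDiff D t i i = (D.map (· ^ 2)).mulVec z i := by
  classical
  induction n with
  | zero =>
    intro t ht _
    have : t = 0 := by ext i j; exact ht i j (Nat.zero_le _)
    exact ⟨0, fun i _ => by simp [this]⟩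
  | succ n ih =>
    intro t ht hz
    have ht' : ∀ i j, n < deg i + deg j → t i j = 0 := ht
    rcases Nat.eq_zero_or_pos n with rfl | hn
    · refine ⟨0, fun i hi => ?_⟩
      rw [hdeg.tateDiff_apply_top ht' (Nat.zero_le _), CharTwo.add_self_eq_zero]
      simp
    have hsymm : ∀ i j, deg i + deg j = n → t i j + t j i = 0 := fun i j h => by
      rw [← hdeg.tateDiff_apply_top ht' h.ge]; exact hz i j (by omega)
    -- the case where the diagonal of the top component vanishes
    have key : ∀ s : Matrix ι ι R, (∀ i j, n < deg i + deg j → s i j = 0) →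
        (∀ i j, deg i + deg j = n → s i j + s j i = 0) → (∀ i, 2 * deg i = n → s i i = 0) →
        tateDiff D s = tateDiff D t →
        ∃ z, ∀ i, deg i = 0 → tateDiff D t i i = (D.map (· ^ 2)).mulVec z i := by
      intro s hs1 hs2 hs3 hst
      obtain ⟨y, hy⟩ := hdeg.exists_sub_tateDiff hs1 hs2 hs3
      have e : tateDiff D (s - tateDiff D y) = tateDiff D t := by
        rw [map_sub, tateDiff_tateDiff hD, sub_zero, hst]
      rw [← e] at hz ⊢
      exact ih _ hy hz
    obtain ⟨p, hp | hp⟩ := n.even_or_odd'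
    swap
    · exact key t ht' hsymm (fun i hi => by omega) rfl
    obtain ⟨p, rfl⟩ : ∃ q, p = q + 1 := ⟨p - 1, by omega⟩
    let z : ι → R := fun i => if deg i = p + 1 then t i i else 0
    have hz0 : ∀ i, deg i ≠ p + 1 → z i = 0 := fun i hi => if_neg hi
    let Z := Matrix.diagonal z
    have hZ : Z.transpose = Z := Matrix.diagonal_transpose z
    have hZ0 : ∀ i j, deg i + deg j ≠ n → Z i j = 0 := fun i j h => by
      simp only [Z, Matrix.diagonal_apply]
      split_ifs with hij
      · subst hij; exact hz0 i (by omega)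
      · rfl
    have hDZ0 : ∀ i j, n ≤ deg i + deg j → (D * Z) i j = 0 := fun i j h => by
      rw [Matrix.mul_diagonal]
      by_cases hj : deg j = p + 1
      · rw [hdeg.eq_zero (by omega), zero_mul]
      · rw [hz0 j hj, mul_zero]
    have hZsymm : ∀ i j, Z j i = Z i j := fun i j => congrFun (congrFun hZ i) j
    let t1 := t - (Z + D * Z)
    have ht1 : tateDiff D t1 = tateDiff D t - D * Z * D.transpose := by
      rw [map_sub, tateDiff_sandwich hD hZ]
    obtain ⟨y, hy⟩ : ∃ y, ∀ i j, n ≤ deg i + deg j → (t1 - tateDiff D y) i j = 0 := by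
      refine hdeg.exists_sub_tateDiff (fun i j h => ?_) (fun i j h => ?_) (fun i h => ?_)
      · simp [t1, ht' i j h, hZ0 i j h.ne', hDZ0 i j h.le]
      · have := hsymm i j h
        simp only [t1, Matrix.sub_apply, Matrix.add_apply, hDZ0 i j h.ge,
          hDZ0 j i (by omega), hZsymm i j]
        rw [show t i j - (Z i j + 0) + (t j i - (Z i j + 0)) = t i j + t j i - (Z i j + Z i j) by
          ring, this, CharTwo.add_self_eq_zero, sub_zero]
      · have : deg i = p + 1 := by omega
        simp [t1, hDZ0 i i (by omega), Z, z, this]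
    let t2 := t1 - tateDiff D y
    have ht2 : tateDiff D t2 = tateDiff D t - D * Z * D.transpose := by
      rw [map_sub, tateDiff_tateDiff hD, sub_zero, ht1]
    have hS : ∀ i j, deg i + deg j + 2 ≠ n → (D * Z * D.transpose) i j = 0 := fun i j h =>
      hdeg.sandwich_apply_eq_zero hz0 (by omega)
    have hy2 : ∀ i j, 2 * p + 1 < deg i + deg j → t2 i j = 0 := fun i j h => hy i j (by omega)
    obtain ⟨y', hy'⟩ : ∃ y', ∀ i j, 2 * p + 1 ≤ deg i + deg j → (t2 - tateDiff D y') i j = 0 := by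
      refine hdeg.exists_sub_tateDiff hy2 (fun i j h => ?_) (fun i h => by omega)
      rw [← hdeg.tateDiff_apply_top hy2 h.ge, ht2, Matrix.sub_apply, hz i j (by omega),
        hS i j (by omega), sub_zero]
    have hpz : ∀ i, deg i = p → tateDiff D t i i = (D.map (· ^ 2)).mulVec z i := fun i hi => by
      rw [← sandwich_diagonal_apply_self, ← sub_eq_zero, ← Matrix.sub_apply]
      have : tateDiff D (t2 - tateDiff D y') = tateDiff D t - D * Z * D.transpose := by
        rw [map_sub, tateDiff_tateDiff hD, sub_zero, ht2]
      rw [← this, hdeg.tateDiff_apply_top (n := 2 * p) hy' (by omega),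
        CharTwo.add_self_eq_zero]
    rcases Nat.eq_zero_or_pos p with rfl | hp0
    · exact ⟨z, hpz⟩
    obtain ⟨z', hz'⟩ : ∃ z', (D.map (· ^ 2)).mulVec z' = z := by
      refine hac z ?_ (fun i hi => hz0 i (by omega))
      ext i
      by_cases hi : deg i = p
      · rw [← hpz i hi, hz i i (by omega)]; rfl
      · exact (hdeg.map two_ne_zero).sum_left_eq_zero fun l hl => hz0 l (by omega)
    let w : ι → R := fun l => if deg l = p + 1 + 1 then z' l else 0
    have hw0 : ∀ i, deg i ≠ p + 1 + 1 → w i = 0 := fun i hi => if_neg hi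
    have hw : (D.map (· ^ 2)).mulVec w = z := by
      ext i
      rw [(hdeg.map two_ne_zero).mulVec_restrict, hz']
      split_ifs with h
      · rfl
      · exact (hz0 i h).symm
    let W := Matrix.diagonal w
    have hW : W.transpose = W := Matrix.diagonal_transpose w
    let b := D * W * D.transpose
    have hbT : b.transpose = b := by
      simp [b, Matrix.transpose_mul, hW, Matrix.mul_assoc]
    have hb0 : ∀ i j, n < deg i + deg j → b i j = 0 := fun i j h =>
      hdeg.sandwich_apply_eq_zero hw0 (by omega)
    refine key (t - b) (fun i j h => ?_) (fun i j h => ?_) (fun i h => ?_) ?_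
    · simp [ht' i j h, hb0 i j h]
    · have h1 := hsymm i j h
      have h2 : b j i = b i j := congrFun (congrFun hbT i) j
      rw [Matrix.sub_apply, Matrix.sub_apply, h2, show t i j - b i j + (t j i - b i j)
        = t i j + t j i - (b i j + b i j) by ring, h1, CharTwo.add_self_eq_zero, sub_zero]
    · rw [Matrix.sub_apply, show b i i = _ from sandwich_diagonal_apply_self D w i, hw]
      simp [z, show deg i = p + 1 by omega]
    · have : tateDiff D b = 0 := by
        rw [show b = _ from (tateDiff_sandwich hD hW).symm, tateDiff_tateDiff hD]
      rw [map_sub, this, sub_zero]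

/-- The vectors whose degree-zero part is a boundary. -/
def boundaryZero (deg : ι → ℕ) (D : Matrix ι ι R) : Submodule R (ι → R) where
  carrier := {x | ∃ y, ∀ i, deg i = 0 → D.mulVec y i = x i}
  add_mem' := by
    rintro a b ⟨y, hy⟩ ⟨z, hz⟩
    exact ⟨y + z, fun i hi => by rw [Matrix.mulVec_add, Pi.add_apply, hy i hi, hz i hi]; rfl⟩
  zero_mem' := ⟨0, fun i _ => by simp⟩
  smul_mem' := by
    rintro r a ⟨y, hy⟩
    exact ⟨r • y, fun i hi => by rw [Matrix.mulVec_smul, Pi.smul_apply, hy i hi]; rfl⟩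

theorem Module.length_le_of_ker_le {R X Y Z : Type*} [Ring R] [AddCommGroup X] [Module R X]
    [AddCommGroup Y] [Module R Y] [AddCommGroup Z] [Module R Z] (f : X →ₗ[R] Y) (g : X →ₗ[R] Z)
    (hg : Function.Surjective g) (h : LinearMap.ker f ≤ LinearMap.ker g) :
    Module.length R Z ≤ Module.length R Y :=
  calc Module.length R Z ≤ Module.length R (X ⧸ LinearMap.ker f) :=
        Module.length_le_of_surjective ((LinearMap.ker f).liftQ g h) fun z => by
          obtain ⟨x, rfl⟩ := hg z
          exact ⟨Submodule.Quotient.mk x, rfl⟩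
    _ ≤ Module.length R Y :=
        Module.length_le_of_injective ((LinearMap.ker f).liftQ f le_rfl)
          (LinearMap.ker_eq_bot.1 (Submodule.ker_liftQ_eq_bot _ _ _ le_rfl))

/-- If a linear map on `K` has kernel contained in `K' + B` then it bounds the growth of length
from the image of `K'` to the image of `K` modulo `B`. -/
theorem Submodule.length_map_mkQ_le {R X Q : Type*} [Ring R] [AddCommGroup X] [Module R X]
    [AddCommGroup Q] [Module R Q] (B K K' : Submodule R X) (hK : K' ≤ K) (f : K →ₗ[R] Q)
    (h : ∀ x : K, f x = 0 → (x : X) ∈ K' ⊔ B) :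
    Module.length R (K.map B.mkQ) ≤ Module.length R (K'.map B.mkQ) + Module.length R Q := by
  let V := K.map B.mkQ
  let V' := K'.map B.mkQ
  have hV : V' ≤ V := Submodule.map_mono hK
  rw [Module.length_eq_add_of_exact (Submodule.inclusion hV) ((V'.comap V.subtype).mkQ)
    (Submodule.inclusion_injective hV) (Submodule.mkQ_surjective _) (by
      rw [LinearMap.exact_iff, Submodule.ker_mkQ, Submodule.range_inclusion])]
  gcongr
  refine Module.length_le_of_ker_le f
    ((V'.comap V.subtype).mkQ ∘ₗ (B.mkQ.restrict (fun x hx => Submodule.mem_map_of_mem hx) :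
      K →ₗ[R] V)) ((Submodule.mkQ_surjective _).comp ?_) ?_
  · rintro ⟨_, x, hx, rfl⟩
    exact ⟨⟨x, hx⟩, rfl⟩
  · intro x hx
    obtain ⟨u, hu, b, hb, hub⟩ := Submodule.mem_sup.1 (h x hx)
    rw [LinearMap.mem_ker, LinearMap.comp_apply, Submodule.mkQ_apply,
      Submodule.Quotient.mk_eq_zero, Submodule.mem_comap]
    refine ⟨u, hu, ?_⟩
    change Submodule.Quotient.mk u = Submodule.Quotient.mk (x : X)
    rw [Submodule.Quotient.eq, ← hub]
    simpa using hb

/-- Cycles of the perturbed tensor square of weight at least `a`, where the bidegree `(p, q)`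
has weight `L * p + (L + 1) * q`. -/
def weightCycles (deg : ι → ℕ) (D : Matrix ι ι R) (L a : ℕ) : Submodule R (Matrix ι ι R) where
  carrier := {t | tateDiff D t = 0 ∧ ∀ i j, L * deg i + (L + 1) * deg j < a → t i j = 0}
  add_mem' := by
    rintro s t ⟨hs, hs'⟩ ⟨ht, ht'⟩
    exact ⟨by rw [map_add, hs, ht, add_zero], fun i j h => by
      rw [Matrix.add_apply, hs' i j h, ht' i j h, add_zero]⟩
  zero_mem' := ⟨map_zero _, fun _ _ _ => rfl⟩
  smul_mem' := by
    rintro r s ⟨hs, hs'⟩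
    exact ⟨by rw [map_smul, hs, smul_zero], fun i j h => by
      rw [Matrix.smul_apply, hs' i j h, smul_zero]⟩

theorem weightCycles_mem_sup [CharP R 2] (hdeg : LowersDegree deg D) (hD : D * D = 0)
    (hac : AcyclicPos deg D) {L : ℕ} (hL : ∀ i, deg i < L) {a : ℕ} {x : Matrix ι ι R}
    (hx : x ∈ weightCycles deg D L a)
    (h0 : ∀ i, L * deg i = a → x i ∈ boundaryZero deg D) :
    x ∈ weightCycles deg D L (a + 1) ⊔ LinearMap.range (tateDiff D) := by
  classical
  obtain ⟨hx, hxa⟩ := hx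
  have key : ∀ i, ∃ u : ι → R, ∀ j, L * deg i + (L + 1) * deg j = a → D.mulVec u j = x i j := by
    intro i
    by_cases hi : L * deg i = a
    · obtain ⟨u, hu⟩ := h0 i hi
      refine ⟨u, fun j hj => hu j ?_⟩
      by_contra h
      have : 0 < (L + 1) * deg j := by positivity
      omega
    · obtain ⟨u, hu⟩ := hac (fun j => if L * deg i + (L + 1) * deg j = a then x i j else 0) (by
        ext j
        by_cases hj : L * deg i + (L + 1) * deg j + (L + 1) = a
        · have h1 := congrFun (congrFun hx i) j
          have hl : ∀ l, deg l = deg i + 1 → L * deg l + (L + 1) * deg j < a := fun l hl => by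
            rw [hl, mul_add]; omega
          have hji : L * deg j + (L + 1) * deg i < a := by
            have := hL i
            nlinarith
          rw [tateDiff_apply_apply, hdeg.sum_left_eq_zero (fun l h => hxa l j (hl l h)),
            hxa i j (by omega), hxa j i hji, zero_add, add_zero, add_zero] at h1
          refine Eq.trans ?_ h1
          refine Finset.sum_congr rfl fun l _ => ?_
          change D j l * (if L * deg i + (L + 1) * deg l = a then x i l else 0) = x i l * D j l
          by_cases h : deg l = deg j + 1
          · rw [if_pos (by rw [h, mul_add]; omega), mul_comm]
          · rw [hdeg.eq_zero h, zero_mul, mul_zero]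
        · refine hdeg.sum_left_eq_zero fun l hl => if_neg ?_
          rw [hl, mul_add]; omega) (fun j hj => if_neg (by simpa [hj] using hi))
      exact ⟨u, fun j hj => (congrFun hu j).trans (if_pos hj)⟩
  choose u hu using key
  let y : Matrix ι ι R := fun i l =>
    if L * deg i + (L + 1) * deg l = a + (L + 1) then u i l else 0
  have hy : ∀ i l, L * deg i + (L + 1) * deg l ≠ a + (L + 1) → y i l = 0 := fun i l h => if_neg h
  refine Submodule.mem_sup.2 ⟨x - tateDiff D y, ⟨?_, fun i j h => ?_⟩, tateDiff D y, ⟨y, rfl⟩,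
    sub_add_cancel _ _⟩
  · rw [map_sub, tateDiff_tateDiff hD, hx, sub_zero]
  have hyD : ∑ l, y i l * D j l = x i j := by
    by_cases hj : L * deg i + (L + 1) * deg j = a
    · rw [← hu i j hj]
      refine Finset.sum_congr rfl fun l _ => ?_
      change _ = D j l * _
      by_cases h : deg l = deg j + 1
      · rw [mul_comm]
        simp only [y]
        rw [if_pos (by rw [h, mul_add]; omega)]
      · rw [hdeg.eq_zero h, zero_mul, mul_zero]
    · rw [hxa i j (by omega)]
      refine hdeg.sum_right_eq_zero fun l hl => hy i l ?_
      rw [hl, mul_add]; omega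
  have hDy : ∑ l, D i l * y l j = 0 := hdeg.sum_left_eq_zero fun l hl => hy l j (by
    rw [hl, mul_add]; omega)
  have hyij : y i j = 0 := hy i j (by omega)
  have hyji : y j i = 0 := hy j i (by have := hL i; nlinarith)
  rw [Matrix.sub_apply, tateDiff_apply_apply, hyD, hDy, hyij, hyji]
  simp

theorem length_weightCycles_le [CharP R 2] (hdeg : LowersDegree deg D) (hD : D * D = 0)
    (hac : AcyclicPos deg D) {L : ℕ} (hL : ∀ i, deg i < L) (a : ℕ) :
    Module.length R ((weightCycles deg D L a).map (LinearMap.range (tateDiff D)).mkQ) ≤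
      Module.length R ((weightCycles deg D L (a + 1)).map (LinearMap.range (tateDiff D)).mkQ) +
      Nat.card {i // L * deg i = a} * Module.length R ((ι → R) ⧸ boundaryZero deg D) := by
  classical
  let f : Matrix ι ι R →ₗ[R] ({i // L * deg i = a} → (ι → R) ⧸ boundaryZero deg D) :=
    LinearMap.pi fun i => (boundaryZero deg D).mkQ ∘ₗ LinearMap.proj i.1
  have := Submodule.length_map_mkQ_le (LinearMap.range (tateDiff D)) (weightCycles deg D L a)
    (weightCycles deg D L (a + 1)) (fun t ht => ⟨ht.1, fun i j h => ht.2 i j (by omega)⟩)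
    (f ∘ₗ Submodule.subtype _) (fun x hx => by
      refine weightCycles_mem_sup hdeg hD hac hL x.2 fun i hi => ?_
      rw [← Submodule.Quotient.mk_eq_zero]
      exact congrFun hx ⟨i, hi⟩)
  refine this.trans ?_
  rw [Module.length_pi, ENat.card_eq_coe_natCard]

/-- The key inequality: passing to the Frobenius twist multiplies the length of `H₀` by at most
the total rank, provided both complexes are acyclic in positive degrees. -/
theorem length_frobenius_le [CharP R 2] (hdeg : LowersDegree deg D) (hD : D * D = 0)
    (hac : AcyclicPos deg D) (hac2 : AcyclicPos deg (D.map (· ^ 2))) :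
    Module.length R ((ι → R) ⧸ boundaryZero deg (D.map (· ^ 2))) ≤
      Fintype.card ι * Module.length R ((ι → R) ⧸ boundaryZero deg D) := by
  classical
  obtain ⟨L, hL⟩ : ∃ L, ∀ i, deg i < L :=
    ⟨(Finset.univ.sup deg) + 1, fun i => Nat.lt_succ_of_le (Finset.le_sup (Finset.mem_univ i))⟩
  let B := LinearMap.range (tateDiff D)
  let V := fun a => (weightCycles deg D L a).map B.mkQ
  have h1 : Module.length R ((ι → R) ⧸ boundaryZero deg (D.map (· ^ 2))) ≤
      Module.length R (V 0) := by
    let g : (ι → R) →ₗ[R] Matrix ι ι R :=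
      { toFun := fun c => Matrix.diagonal fun i => if deg i = 0 then c i else 0
        map_add' := fun c c' => by
          rw [Matrix.diagonal_add]; congr 1; ext i; simp only [Pi.add_apply]; split_ifs <;> simp
        map_smul' := fun r c => by
          rw [RingHom.id_apply, ← Matrix.diagonal_smul]; congr 1; ext i
          simp only [Pi.smul_apply]; split_ifs <;> simp }
    have hg : ∀ c, g c ∈ weightCycles deg D L 0 := fun c => by
      refine ⟨?_, fun _ _ h => absurd h (Nat.not_lt_zero _)⟩
      have h0 : D * g c = 0 := by
        ext i l
        change (D * (Matrix.diagonal (fun i => if deg i = 0 then c i else 0) : Matrix ι ι R)) i l = 0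
        rw [Matrix.mul_diagonal]
        split_ifs with h
        · rw [hdeg.eq_zero (by omega), zero_mul]
        · rw [mul_zero]
      have hT : (g c).transpose = g c := Matrix.diagonal_transpose _
      have h0' : g c * D.transpose = 0 := by
        rw [← hT, ← Matrix.transpose_mul, h0, Matrix.transpose_zero]
      rw [tateDiff_apply, h0, h0', hT]
      ext i j
      simp only [zero_add]
      exact CharTwo.add_self_eq_zero _
    refine Module.length_le_of_ker_le
      (LinearMap.codRestrict (V 0) (B.mkQ ∘ₗ g) fun c => Submodule.mem_map_of_mem (hg c))
      (boundaryZero deg (D.map (· ^ 2))).mkQ (Submodule.mkQ_surjective _) fun c hc => ?_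
    have hc' : B.mkQ (g c) = 0 := congrArg Subtype.val hc
    rw [Submodule.mkQ_apply, Submodule.Quotient.mk_eq_zero] at hc'
    obtain ⟨t, ht⟩ := hc'
    rw [Submodule.ker_mkQ]
    obtain ⟨z, hz⟩ := diag_tateDiff_mem hdeg hD hac2 (2 * L) t
      (fun i j h => by have := hL i; have := hL j; omega) (fun i j h => by
        rw [ht]
        change Matrix.diagonal _ i j = 0
        by_cases hij : i = j
        · subst hij
          rw [Matrix.diagonal_apply_eq, if_neg (by omega)]
        · exact Matrix.diagonal_apply_ne _ hij)
    refine ⟨z, fun i hi => ?_⟩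
    rw [← hz i hi, ht]
    change Matrix.diagonal _ i i = c i
    rw [Matrix.diagonal_apply_eq, if_pos hi]
  have h2 : ∀ n, Module.length R (V 0) ≤ Module.length R (V n) +
      ((∑ a ∈ Finset.range n, Nat.card {i // L * deg i = a} : ℕ) : ℕ∞) *
        Module.length R ((ι → R) ⧸ boundaryZero deg D) := by
    intro n
    induction n with
    | zero => simp
    | succ n ih =>
      refine ih.trans ?_
      rw [Finset.sum_range_succ, Nat.cast_add, add_mul,
        add_comm (_ * _) ((Nat.card {i // L * deg i = n} : ℕ∞) * _), ← add_assoc]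
      gcongr
      exact length_weightCycles_le hdeg hD hac hL n
  have h3 : V (L * L + (L + 1) * L) = ⊥ := by
    have : weightCycles deg D L (L * L + (L + 1) * L) = ⊥ := by
      rw [eq_bot_iff]
      rintro t ⟨-, ht⟩
      ext i j
      exact ht i j (add_lt_add (Nat.mul_lt_mul_of_pos_left (hL i) (by have := hL i; omega))
        (Nat.mul_lt_mul_of_pos_left (hL j) (by omega)))
    simp only [V, this, Submodule.map_bot]
  refine h1.trans ((h2 (L * L + (L + 1) * L)).trans ?_)
  rw [h3, Module.length_bot, zero_add]
  gcongr
  have h4 : ∀ a, Nat.card {i // L * deg i = a} = (Finset.univ.filter fun i => L * deg i = a).card :=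
    fun a => by rw [Nat.card_eq_fintype_card, Fintype.card_subtype]
  simp only [h4]
  rw [← Finset.card_biUnion (fun a _ b _ hab => Finset.disjoint_filter.2 fun i _ h h' =>
    hab (h.symm.trans h'))]
  exact Finset.card_le_univ _

end TensorSquare

section ResidueExt

open Abelian IsLocalRing

universe u

variable {R : Type u} [CommRing R] [IsLocalRing R]

/-- `Ext^j(k, N)` for the residue field `k` of a local ring. -/
abbrev ResidueExt (R : Type u) [CommRing R] [IsLocalRing R] (N : Type u) [AddCommGroup N]
    [Module R N] (j : ℕ) : Type u :=
  Ext (ModuleCat.of R (ResidueField R)) (ModuleCat.of R N) j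

variable {N N' : Type u} [AddCommGroup N] [AddCommGroup N'] [Module R N'] [Module R N]

/-- The map induced on `Ext^j(k, -)`. -/
noncomputable def ResidueExt.map (f : N →ₗ[R] N') {j : ℕ} (x : ResidueExt R N j) :
    ResidueExt R N' j :=
  x.comp (Ext.mk₀ (ModuleCat.ofHom f)) (add_zero j)

theorem ResidueExt.map_comp {N'' : Type u} [AddCommGroup N''] [Module R N'']
    (g : N' →ₗ[R] N'') (f : N →ₗ[R] N') {j : ℕ} (x : ResidueExt R N j) :
    ResidueExt.map (g ∘ₗ f) x = ResidueExt.map g (ResidueExt.map f x) := by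
  simp only [ResidueExt.map, ModuleCat.ofHom_comp, ← Ext.mk₀_comp_mk₀]
  rw [Ext.comp_assoc_of_third_deg_zero]

theorem ResidueExt.map_id {j : ℕ} (x : ResidueExt R N j) :
    ResidueExt.map LinearMap.id x = x :=
  Ext.comp_mk₀_id x

theorem ResidueExt.map_zero (f : N →ₗ[R] N') {j : ℕ} :
    ResidueExt.map f (0 : ResidueExt R N j) = 0 :=
  Ext.zero_comp _ _ _ _ _

theorem ResidueExt.smul_eq_zero {r : R} (hr : r ∈ maximalIdeal R) {j : ℕ}
    (x : ResidueExt R N j) : r • x = 0 := by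
  have h : r • 𝟙 (ModuleCat.of R (ResidueField R)) = 0 := by
    ext y
    change r • y = 0
    rw [Algebra.smul_def, ResidueField.algebraMap_eq, (residue_eq_zero_iff r).2 hr, zero_mul]
  have e : r • x = (Ext.mk₀ (r • 𝟙 (ModuleCat.of R (ResidueField R)))).comp x (zero_add j) := by
    simp [Ext.mk₀_smul]
  rw [e, h, Ext.mk₀_zero, Ext.zero_comp]

theorem ResidueExt.map_sum_smul {ι : Type*} [Fintype ι] (r : ι → R) (f : ι → N →ₗ[R] N')
    {j : ℕ} (x : ResidueExt R N j) :
    ResidueExt.map (∑ i, r i • f i) x = ∑ i, r i • ResidueExt.map (f i) x := by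
  have : ModuleCat.ofHom (∑ i, r i • f i) = ∑ i, r i • ModuleCat.ofHom (f i) := by
    ext y
    simp [ModuleCat.hom_sum]
  simp only [ResidueExt.map, this, Ext.mk₀_sum, Ext.comp_sum, Ext.mk₀_smul, Ext.comp_smul]

theorem ResidueExt.map_sum {ι : Type*} [Fintype ι] (f : ι → N →ₗ[R] N')
    {j : ℕ} (x : ResidueExt R N j) :
    ResidueExt.map (∑ i, f i) x = ∑ i, ResidueExt.map (f i) x := by
  simpa using ResidueExt.map_sum_smul (fun _ => (1 : R)) f x

theorem ResidueExt.subsingleton_of_retract (f : N →ₗ[R] N') (g : N' →ₗ[R] N)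
    (h : g ∘ₗ f = LinearMap.id) {j : ℕ} [Subsingleton (ResidueExt R N' j)] :
    Subsingleton (ResidueExt R N j) :=
  subsingleton_of_forall_eq 0 fun x => by
    rw [← ResidueExt.map_id x, ← h, ResidueExt.map_comp,
      Subsingleton.elim (ResidueExt.map f x) 0, ResidueExt.map_zero]

theorem ResidueExt.subsingleton_pi {ι : Type} [Fintype ι] {j : ℕ}
    [Subsingleton (ResidueExt R R j)] : Subsingleton (ResidueExt R (ι → R) j) := by
  classical
  refine subsingleton_of_forall_eq 0 fun x => ?_
  have h : (∑ i : ι, LinearMap.single R (fun _ => R) i ∘ₗ LinearMap.proj i) =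
      (LinearMap.id : (ι → R) →ₗ[R] (ι → R)) := by
    ext i l
    simp [Pi.single_apply]
  rw [← ResidueExt.map_id x, ← h, ResidueExt.map_sum]
  refine Finset.sum_eq_zero fun i _ => ?_
  rw [ResidueExt.map_comp,
    Subsingleton.elim (ResidueExt.map (LinearMap.proj i : (ι → R) →ₗ[R] R) x) 0,
    ResidueExt.map_zero]

theorem ResidueExt.map_mulVecLin_eq_zero {ι κ : Type} [Fintype ι] [Fintype κ]
    (A : Matrix ι κ R) (hA : ∀ i l, A i l ∈ maximalIdeal R) {j : ℕ}
    (x : ResidueExt R (κ → R) j) : ResidueExt.map A.mulVecLin x = 0 := by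
  classical
  have h : A.mulVecLin = ∑ p : ι × κ, A p.1 p.2 •
      (LinearMap.single R (fun _ => R) p.1 ∘ₗ LinearMap.proj p.2 : (κ → R) →ₗ[R] (ι → R)) := by
    ext l i
    simp [Pi.single_apply, Fintype.sum_prod_type, Finset.sum_apply]
  rw [h, ResidueExt.map_sum_smul]
  exact Finset.sum_eq_zero fun p _ => ResidueExt.smul_eq_zero (hA _ _) _

theorem ResidueExt.eq_zero_of_map_subtype (f : N →ₗ[R] N') (hf : Function.Surjective f)
    {j : ℕ} [Subsingleton (ResidueExt R N' j)] (x : ResidueExt R (LinearMap.ker f) (j + 1))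
    (hx : ResidueExt.map (LinearMap.ker f).subtype x = 0) : x = 0 := by
  obtain ⟨y, rfl⟩ := Ext.covariant_sequence_exact₁ _ (LinearMap.shortExact_shortComplexKer hf) x hx
    (n₀ := j) rfl
  rw [Subsingleton.elim (α := ResidueExt R N' j) y 0, Ext.zero_comp]

theorem ResidueExt.subsingleton_of_surjective (f : N →ₗ[R] N') (hf : Function.Surjective f)
    {j : ℕ} [Subsingleton (ResidueExt R N j)]
    [Subsingleton (ResidueExt R (LinearMap.ker f) (j + 1))] :
    Subsingleton (ResidueExt R N' j) :=
  subsingleton_of_forall_eq 0 fun x => by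
    obtain ⟨y, rfl⟩ := Ext.covariant_sequence_exact₃ _ (LinearMap.shortExact_shortComplexKer hf) x
      (n₁ := j + 1) rfl (Subsingleton.elim (α := ResidueExt R (LinearMap.ker f) (j + 1)) _ _)
    rw [Subsingleton.elim (α := ResidueExt R N j) y 0, Ext.zero_comp]

theorem ResidueExt.eq_zero_of_injective (f : N →ₗ[R] N') (hf : Function.Injective f)
    (x : ResidueExt R N 0) (hx : ResidueExt.map f x = 0) : x = 0 := by
  have : Mono (ModuleCat.ofHom f) := (ModuleCat.mono_iff_injective _).2 hf
  refine Abelian.Ext.postcomp_mk₀_injective_of_mono _ (ModuleCat.ofHom f) (hx.trans ?_)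
  exact (ResidueExt.map_zero f).symm

theorem ResidueExt.eq_zero_of_forall_smul [h : Subsingleton (ResidueExt R N 0)] {x : N}
    (hx : ∀ r ∈ maximalIdeal R, r • x = 0) : x = 0 := by
  let f : ResidueField R →ₗ[R] N :=
    (maximalIdeal R).liftQ (LinearMap.toSpanSingleton R N x) (fun r hr => by simpa using hx r hr)
  have h0 : ModuleCat.ofHom f = 0 := (Ext.mk₀_eq_zero_iff _).1 (h.elim _ _)
  have h1 : f (Submodule.Quotient.mk 1) = 0 :=
    congrArg (fun g : ModuleCat.of R (ResidueField R) ⟶ ModuleCat.of R N =>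
      g.hom (Submodule.Quotient.mk 1)) h0
  exact (one_smul R x).symm.trans h1

theorem ResidueExt.subsingleton_of_subsingleton [Subsingleton N] (j : ℕ) :
    Subsingleton (ResidueExt R N j) :=
  subsingleton_of_forall_eq 0 fun x => by
    rw [← ResidueExt.map_id x, show (LinearMap.id : N →ₗ[R] N) = ∑ i : Empty, i.elim from
      LinearMap.ext fun _ => Subsingleton.elim _ _, ResidueExt.map_sum]
    simp


variable {b : ℕ → ℕ} (δ : ∀ i, Matrix (Fin (b i)) (Fin (b (i + 1))) R)

theorem ResidueExt.subsingleton_of_le [Subsingleton (ResidueExt R N' 0)] (f : N →ₗ[R] N')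
    (hf : Function.Injective f) : Subsingleton (ResidueExt R N 0) :=
  subsingleton_of_forall_eq 0 fun x =>
    ResidueExt.eq_zero_of_injective f hf x (Subsingleton.elim _ _)

/-- A minimal free resolution of length `s` (possibly with a cokernel) forces the vanishing of
`Ext^j(k, R)` for `j < s`. -/
theorem subsingleton_residueExt_of_minimal
    (hmin : ∀ i p q, δ i p q ∈ maximalIdeal R)
    (hex : ∀ i, LinearMap.ker (δ i).mulVecLin = LinearMap.range (δ (i + 1)).mulVecLin)
    {s : ℕ} (hs : b s ≠ 0) (hs' : b (s + 1) = 0) (t : ℕ) (ht : t < s) :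
    Subsingleton (ResidueExt R R t) := by
  induction t using Nat.strong_induction_on with
  | _ t ih =>
  have hF : ∀ j, j < t → ∀ m, Subsingleton (ResidueExt R (Fin (b m) → R) j) := fun j hj m =>
    have := ih j hj (hj.trans ht)
    ResidueExt.subsingleton_pi
  have hB : ∀ j, j < t → ∀ m, j ≤ m →
      Subsingleton (ResidueExt R (LinearMap.range (δ m).mulVecLin) j) := by
    intro j
    induction j with
    | zero =>
      intro hj m _
      have := hF 0 hj m
      exact ResidueExt.subsingleton_of_le (Submodule.subtype _) (Submodule.subtype_injective _)
    | succ j ihj =>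
      intro hj m hm
      obtain ⟨m, rfl⟩ : ∃ l, m = l + 1 := ⟨m - 1, by omega⟩
      have := ihj (by omega) m (by omega)
      have := hF (j + 1) hj (m + 1)
      rw [← hex m, ← LinearMap.ker_rangeRestrict]
      exact subsingleton_of_forall_eq 0 fun x => ResidueExt.eq_zero_of_map_subtype _
        (LinearMap.surjective_rangeRestrict _) x (Subsingleton.elim _ _)
  obtain ⟨s, rfl⟩ : ∃ l, s = l + 1 := ⟨s - 1, by omega⟩
  have hinj : ∀ x : ResidueExt R (LinearMap.range (δ s).mulVecLin) t,
      ResidueExt.map (Submodule.subtype _) x = 0 → x = 0 := by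
    rcases t with - | t
    · exact ResidueExt.eq_zero_of_injective _ (Submodule.subtype_injective _)
    · obtain ⟨s, rfl⟩ : ∃ l, s = l + 1 := ⟨s - 1, by omega⟩
      have := hB t (by omega) s (by omega)
      rw [← hex s, ← LinearMap.ker_rangeRestrict]
      exact ResidueExt.eq_zero_of_map_subtype _ (LinearMap.surjective_rangeRestrict _)
  have hfs : Function.Injective (δ s).mulVecLin := by
    rw [← LinearMap.ker_eq_bot, hex s, LinearMap.range_eq_bot]
    have : IsEmpty (Fin (b (s + 1 + 1))) := by rw [hs']; infer_instance
    exact LinearMap.ext fun x => by rw [Subsingleton.elim x 0, _root_.map_zero, _root_.map_zero]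
  have hsub : Subsingleton (ResidueExt R (Fin (b (s + 1)) → R) t) :=
    subsingleton_of_forall_eq 0 fun x => by
      let e := LinearEquiv.ofInjective _ hfs
      have h1 : ResidueExt.map e.toLinearMap x = 0 := by
        refine hinj _ ?_
        rw [← ResidueExt.map_comp]
        exact ResidueExt.map_mulVecLin_eq_zero (δ s) (hmin s) x
      rw [← ResidueExt.map_id x, show (LinearMap.id : (Fin (b (s + 1)) → R) →ₗ[R] _) =
        e.symm.toLinearMap ∘ₗ e.toLinearMap from by simp, ResidueExt.map_comp, h1,
        ResidueExt.map_zero]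
  let i : Fin (b (s + 1)) := ⟨0, Nat.pos_of_ne_zero hs⟩
  exact ResidueExt.subsingleton_of_retract (LinearMap.single R (fun _ => R) i)
    (LinearMap.proj i) (by ext; simp)

/-- A bounded complex of free modules of length `s` with `Ext^j(k, R) = 0` for `j < s`, whose
positive homology is torsion with respect to the maximal ideal, is acyclic. -/
theorem ker_le_range_of_residueExt {s : ℕ} (hs : ∀ i, s < i → b i = 0)
    (hExt : ∀ j, j < s → Subsingleton (ResidueExt R R j))
    (hδ : ∀ i, δ i * δ (i + 1) = 0)
    (htors : ∀ i, ∃ N, ∀ c ∈ maximalIdeal R ^ N, ∀ z ∈ LinearMap.ker (δ i).mulVecLin,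
      c • z ∈ LinearMap.range (δ (i + 1)).mulVecLin) (i : ℕ) :
    LinearMap.ker (δ i).mulVecLin = LinearMap.range (δ (i + 1)).mulVecLin := by
  have hle : ∀ i, LinearMap.range (δ (i + 1)).mulVecLin ≤ LinearMap.ker (δ i).mulVecLin := by
    rintro i _ ⟨y, rfl⟩
    simp [hδ]
  have hzero : ∀ i, s < i → ∀ x : Fin (b i) → R, x = 0 := fun i hi x => by
    have : IsEmpty (Fin (b i)) := by rw [hs i hi]; infer_instance
    exact Subsingleton.elim _ _
  have hF : ∀ j, j < s → ∀ m, Subsingleton (ResidueExt R (Fin (b m) → R) j) := fun j hj m =>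
    have := hExt j hj
    ResidueExt.subsingleton_pi
  suffices ∀ n i, s ≤ i + n →
      LinearMap.ker (δ i).mulVecLin = LinearMap.range (δ (i + 1)).mulVecLin from
    this s i (by omega)
  intro n
  induction n with
  | zero =>
    intro i hi
    refine le_antisymm (fun x _ => ?_) (hle i)
    rw [hzero (i + 1) (by omega) x]
    exact zero_mem _
  | succ n ih =>
    intro i hi
    refine le_antisymm ?_ (hle i)
    rcases Nat.lt_or_ge i s with his | his
    swap
    · intro x _
      rw [hzero (i + 1) (by omega) x]
      exact zero_mem _
    have hB : ∀ l m j, s ≤ m + l → i < m → j ≤ m →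
        Subsingleton (ResidueExt R (LinearMap.range (δ m).mulVecLin) j) := by
      intro l
      induction l with
      | zero =>
        intro m j hm him hj
        have : Subsingleton (LinearMap.range (δ m).mulVecLin) := by
          refine subsingleton_of_forall_eq 0 ?_
          rintro ⟨_, y, rfl⟩
          rw [Subtype.ext_iff]
          change (δ m).mulVecLin y = 0
          rw [hzero (m + 1) (by omega) y, _root_.map_zero]
        exact ResidueExt.subsingleton_of_subsingleton j
      | succ l ihl =>
        intro m j hm him hj
        rcases Nat.lt_or_ge m s with hms | hms
        swap
        · exact ihl m j (by omega) him hj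
        have h1 := ihl (m + 1) (j + 1) (by omega) (by omega) (by omega)
        rw [← ih m (by omega), ← LinearMap.ker_rangeRestrict] at h1
        have := hF j (by omega) (m + 1)
        exact ResidueExt.subsingleton_of_surjective _ (LinearMap.surjective_rangeRestrict _)
    have hB1 := hB s (i + 1) 1 (by omega) (by omega) (by omega)
    let Z := LinearMap.ker (δ i).mulVecLin
    let B := LinearMap.range (δ (i + 1)).mulVecLin
    have hZ : Subsingleton (ResidueExt R Z 0) :=
      have := hF 0 (by omega) (i + 1)
      ResidueExt.subsingleton_of_le (Submodule.subtype _) (Submodule.subtype_injective _)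
    have hQ : Subsingleton (ResidueExt R (Z ⧸ B.submoduleOf Z) 0) := by
      have : Subsingleton (ResidueExt R (LinearMap.ker (B.submoduleOf Z).mkQ) (0 + 1)) := by
        rw [Submodule.ker_mkQ]
        let e := Submodule.submoduleOfEquivOfLe (hle i)
        exact ResidueExt.subsingleton_of_retract (N' := B) e.toLinearMap e.symm.toLinearMap
          (by simp)
      exact ResidueExt.subsingleton_of_surjective _ (Submodule.mkQ_surjective _)
    obtain ⟨N, hN⟩ := htors i
    have hq : ∀ N : ℕ, ∀ q : Z ⧸ B.submoduleOf Z, (∀ c ∈ maximalIdeal R ^ N, c • q = 0) →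
        q = 0 := by
      intro N
      induction N with
      | zero => exact fun q hq => by simpa using hq 1 (by simp)
      | succ N ihN =>
        intro q hq
        refine ihN q fun c hc => ResidueExt.eq_zero_of_forall_smul (R := R) fun r hr => ?_
        rw [smul_smul]
        exact hq _ (by rw [pow_succ']; exact Ideal.mul_mem_mul hr hc)
    intro z hz
    have h0 := hq N (Submodule.Quotient.mk ⟨z, hz⟩) fun c hc => by
      rw [← Submodule.Quotient.mk_smul, Submodule.Quotient.mk_eq_zero]
      exact hN c hc z hz
    rwa [Submodule.Quotient.mk_eq_zero] at h0

end ResidueExt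

section HilbertSamuel

open IsLocalRing

theorem add_pow_succ_le_add (a k d : ℕ) :
    (a + k) ^ (d + 1) ≤ a ^ (d + 1) + k * (d + 1) * (a + k) ^ d := by
  induction d with
  | zero => simp
  | succ d ih =>
    have h : a ^ (d + 1) ≤ (a + k) ^ (d + 1) := Nat.pow_le_pow_left (Nat.le_add_right a k) _
    calc (a + k) ^ (d + 1 + 1) = (a + k) * (a + k) ^ (d + 1) := by ring
      _ ≤ (a + k) * (a ^ (d + 1) + k * (d + 1) * (a + k) ^ d) := Nat.mul_le_mul_left _ ih
      _ = a ^ (d + 1 + 1) + (k * a ^ (d + 1) + k * (d + 1) * (a + k) ^ (d + 1)) := by ring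
      _ ≤ a ^ (d + 1 + 1) + (k * (a + k) ^ (d + 1) + k * (d + 1) * (a + k) ^ (d + 1)) := by gcongr
      _ = a ^ (d + 1 + 1) + k * (d + 1 + 1) * (a + k) ^ (d + 1) := by ring

variable {R : Type*} [CommRing R]

theorem Ideal.length_quotient_anti {I J : Ideal R} (h : I ≤ J) :
    Module.length R (R ⧸ J) ≤ Module.length R (R ⧸ I) :=
  Module.length_le_of_surjective (Submodule.factor h) (Submodule.factor_surjective h)

theorem Ideal.length_add_length_le {A A' : Ideal R} (x : R) (h : ∀ y, x * y ∈ A → y ∈ A') :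
    Module.length R (R ⧸ A') + Module.length R (R ⧸ (A ⊔ Ideal.span {x})) ≤
      Module.length R (R ⧸ A) := by
  let g : (R ⧸ A) →ₗ[R] (R ⧸ (A ⊔ Ideal.span {x})) := Submodule.factor le_sup_left
  rw [Module.length_eq_add_of_exact (LinearMap.ker g).subtype g (Submodule.subtype_injective _)
    (Submodule.factor_surjective _) (LinearMap.exact_subtype_ker_map g)]
  gcongr
  refine Module.length_le_of_ker_le (LinearMap.codRestrict (LinearMap.ker g)
    (Submodule.mkQ A ∘ₗ LinearMap.mulLeft R x) fun y => ?_) (Submodule.mkQ A')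
    (Submodule.mkQ_surjective _) fun y hy => ?_
  · exact (Submodule.Quotient.mk_eq_zero _).2 (Ideal.mem_sup_right
      (Ideal.mul_mem_right _ _ (Ideal.mem_span_singleton_self x)))
  · rw [Submodule.ker_mkQ]
    exact h y ((Submodule.Quotient.mk_eq_zero _).1 (congrArg Subtype.val hy))

variable [IsNoetherianRing R]

/-- A consequence of the Artin-Rees lemma. -/
theorem Ideal.exists_mem_sup_pow_of_mul_mem (m p : Ideal R) [p.IsPrime] {x : R} (hx : x ∉ p) :
    ∃ k, ∀ n y, x * y ∈ p ⊔ m ^ (n + k) → y ∈ p ⊔ m ^ n := by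
  let mu : R →ₗ[R] (R ⧸ p) := Submodule.mkQ p ∘ₗ LinearMap.mulLeft R x
  have hmk : ∀ n y, y ∈ p ⊔ m ^ n ↔ Submodule.mkQ p y ∈ m ^ n • (⊤ : Submodule R (R ⧸ p)) := by
    intro n y
    rw [show (⊤ : Submodule R (R ⧸ p)) = (⊤ : Submodule R R).map (Submodule.mkQ p) by
      rw [Submodule.map_top, Submodule.range_mkQ], ← Submodule.map_smul'', smul_eq_mul,
      Ideal.mul_top, ← Submodule.mem_comap, Submodule.comap_map_mkQ]
  obtain ⟨k, hk⟩ := Ideal.exists_pow_inf_eq_pow_smul m (LinearMap.range mu)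
  refine ⟨k, fun n y hy => ?_⟩
  have h1 : mu y ∈ m ^ (n + k) • (⊤ : Submodule R (R ⧸ p)) ⊓ LinearMap.range mu :=
    ⟨(hmk _ _).1 hy, y, rfl⟩
  rw [hk _ (Nat.le_add_left k n), Nat.add_sub_cancel] at h1
  have hle : m ^ n • LinearMap.range mu ≤ Submodule.map mu (m ^ n) := by
    rw [← Submodule.map_top, ← Submodule.map_smul'', smul_eq_mul, Ideal.mul_top]
  obtain ⟨z, hz, hzy⟩ := ((smul_mono_right (m ^ n) inf_le_right).trans hle :
    m ^ n • (m ^ k • ⊤ ⊓ LinearMap.range mu) ≤ Submodule.map mu (m ^ n)) h1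
  have h3 : x * y - x * z ∈ p := by
    rw [← Submodule.Quotient.eq]
    exact hzy.symm
  rw [← mul_sub] at h3
  have h4 := (Ideal.IsPrime.mem_or_mem ‹_› h3).resolve_left hx
  exact Submodule.mem_sup.2 ⟨_, h4, z, hz, sub_add_cancel y z⟩

/-- A lower bound for the Hilbert-Samuel function of a Noetherian local ring. -/
theorem exists_pow_le_length [IsLocalRing R] (d : ℕ) :
    ∀ p : PrimeSpectrum R, (d : ℕ∞) ≤ Order.coheight p → ∃ c : ℕ, ∀ n : ℕ, 0 < n →
      ((n ^ d : ℕ) : ℕ∞) ≤ c * Module.length R (R ⧸ (p.asIdeal ⊔ maximalIdeal R ^ n)) := by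
  have hpos : ∀ p : PrimeSpectrum R, ∀ n : ℕ, 0 < n →
      1 ≤ Module.length R (R ⧸ (p.asIdeal ⊔ maximalIdeal R ^ n)) := fun p n hn => by
    rw [Order.one_le_iff_ne_zero, Ne, Module.length_eq_zero_iff, Ideal.Quotient.subsingleton_iff]
    exact ((sup_le (le_maximalIdeal p.2.ne_top) (Ideal.pow_le_self hn.ne')).trans_lt
      (lt_top_iff_ne_top.2 (Ideal.IsPrime.ne_top inferInstance))).ne
  induction d with
  | zero => exact fun p _ => ⟨1, fun n hn => by simpa using hpos p n hn⟩
  | succ d ih =>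
    intro p hp
    obtain ⟨q, hq, hdq⟩ : ∃ q > p, (d : ℕ∞) ≤ Order.coheight q := by
      by_contra! h
      have := Order.coheight_le_coe_iff.2 h
      exact absurd (hp.trans this) (not_le.2 (Nat.cast_lt.2 d.lt_succ_self))
    obtain ⟨x, hxq, hxp⟩ := SetLike.exists_of_lt (show p.asIdeal < q.asIdeal from hq)
    obtain ⟨c, hc⟩ := ih q hdq
    obtain ⟨k, hk⟩ := Ideal.exists_mem_sup_pow_of_mul_mem (maximalIdeal R) p.asIdeal hxp
    have hk1 : ∀ n y, x * y ∈ p.asIdeal ⊔ maximalIdeal R ^ (n + (k + 1)) →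
        y ∈ p.asIdeal ⊔ maximalIdeal R ^ n := fun n y h =>
      hk n y ((sup_le_sup_left (Ideal.pow_le_pow_right (by omega)) _ :
        p.asIdeal ⊔ maximalIdeal R ^ (n + (k + 1)) ≤ p.asIdeal ⊔ maximalIdeal R ^ (n + k)) h)
    have hstep : ∀ n, Module.length R (R ⧸ (p.asIdeal ⊔ maximalIdeal R ^ n)) +
        Module.length R (R ⧸ (q.asIdeal ⊔ maximalIdeal R ^ (n + (k + 1)))) ≤
        Module.length R (R ⧸ (p.asIdeal ⊔ maximalIdeal R ^ (n + (k + 1)))) := fun n => by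
      refine le_trans ?_ (Ideal.length_add_length_le x (hk1 n))
      gcongr
      refine Ideal.length_quotient_anti (sup_le (sup_le ?_ le_sup_right) ?_)
      · exact (show p.asIdeal ≤ q.asIdeal from hq.le).trans le_sup_left
      · exact ((Ideal.span_singleton_le_iff_mem _).2 hxq).trans le_sup_left
    let C := (k + 1) ^ (d + 1) + (k + 1) * (d + 1) * c
    refine ⟨C, fun n => ?_⟩
    induction n using Nat.strong_induction_on with
    | _ n ihn =>
    intro hn
    rcases Nat.lt_or_ge (k + 1) n with h | h
    · obtain ⟨a, rfl⟩ : ∃ a, n = a + (k + 1) := ⟨n - (k + 1), by omega⟩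
      calc (((a + (k + 1)) ^ (d + 1) : ℕ) : ℕ∞)
          ≤ ((a ^ (d + 1) + (k + 1) * (d + 1) * (a + (k + 1)) ^ d : ℕ) : ℕ∞) :=
            Nat.cast_le.2 (add_pow_succ_le_add a (k + 1) d)
        _ = ((a ^ (d + 1) : ℕ) : ℕ∞) +
            ((k + 1) * (d + 1) : ℕ) * (((a + (k + 1)) ^ d : ℕ) : ℕ∞) := by push_cast; rfl
        _ ≤ C * Module.length R (R ⧸ (p.asIdeal ⊔ maximalIdeal R ^ a)) +
            ((k + 1) * (d + 1) : ℕ) *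
              (c * Module.length R (R ⧸ (q.asIdeal ⊔ maximalIdeal R ^ (a + (k + 1))))) := by
            gcongr
            · exact ihn a (by omega) (by omega)
            · exact hc _ (by omega)
        _ ≤ C * Module.length R (R ⧸ (p.asIdeal ⊔ maximalIdeal R ^ a)) +
            C * Module.length R (R ⧸ (q.asIdeal ⊔ maximalIdeal R ^ (a + (k + 1)))) := by
            rw [← mul_assoc, ← Nat.cast_mul]
            gcongr
            exact Nat.le_add_left _ _
        _ ≤ _ := by
            rw [← mul_add]
            gcongr
            exact hstep a
    · calc ((n ^ (d + 1) : ℕ) : ℕ∞) ≤ (C : ℕ∞) * 1 := by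
            rw [mul_one, Nat.cast_le]
            exact (Nat.pow_le_pow_left h _).trans (Nat.le_add_right _ _)
        _ ≤ _ := by gcongr; exact hpos p n hn

theorem exists_pow_le_length_of_ringKrullDim [IsLocalRing R] {d : ℕ} (hd : ringKrullDim R = d) :
    ∃ c : ℕ, ∀ n : ℕ, 0 < n →
      ((n ^ d : ℕ) : ℕ∞) ≤ c * Module.length R (R ⧸ (maximalIdeal R ^ n)) := by
  obtain ⟨l, hl⟩ := Order.le_krullDim_iff.1 (show (d : WithBot ℕ∞) ≤ Order.krullDim _ from hd.ge)
  obtain ⟨c, hc⟩ := exists_pow_le_length d l.head (by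
    rw [← hl]; exact Order.length_le_coheight_head)
  refine ⟨c, fun n hn => (hc n hn).trans ?_⟩
  gcongr
  exact Ideal.length_quotient_anti le_sup_right

end HilbertSamuel

section MinimalResolution

open IsLocalRing

variable {R : Type} [CommRing R] [IsLocalRing R]

/-- A minimal generating family. -/
theorem exists_minimal_cover (N : Type) [AddCommGroup N] [Module R N] [Module.Finite R N] :
    ∃ (b : ℕ) (g : (Fin b → R) →ₗ[R] N), Function.Surjective g ∧
      ∀ x ∈ LinearMap.ker g, ∀ i, x i ∈ maximalIdeal R := by
  classical
  have hex : ∃ b : ℕ, ∃ v : Fin b → N, Submodule.span R (Set.range v) = ⊤ :=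
    Module.Finite.exists_fin
  obtain ⟨v, hv⟩ := Nat.find_spec hex
  have hmin := fun b => Nat.find_min (m := b) hex
  generalize Nat.find hex = b at v hv hmin
  refine ⟨b, Fintype.linearCombination R v, ?_, fun x hx i => ?_⟩
  · rw [← LinearMap.range_eq_top, Fintype.range_linearCombination, hv]
  · by_contra hxi
    obtain ⟨b, rfl⟩ : ∃ a, b = a + 1 := ⟨b - 1, by have := i.2; omega⟩
    obtain ⟨u, hu⟩ : IsUnit (x i) := by simpa using hxi
    refine hmin b (Nat.lt_succ_self b) ⟨v ∘ i.succAbove, ?_⟩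
    rw [eq_top_iff, ← hv, Submodule.span_le]
    have hother : ∀ j, v (i.succAbove j) ∈ Submodule.span R (Set.range (v ∘ i.succAbove)) :=
      fun j => Submodule.subset_span ⟨j, rfl⟩
    rintro _ ⟨j, rfl⟩
    rcases Fin.eq_self_or_eq_succAbove i j with rfl | ⟨j, rfl⟩
    · rw [LinearMap.mem_ker, Fintype.linearCombination_apply, Fin.sum_univ_succAbove _ j, ← hu,
        add_eq_zero_iff_eq_neg] at hx
      rw [SetLike.mem_coe, ← Submodule.smul_mem_iff_of_isUnit _ u.isUnit, hx]
      exact neg_mem (Submodule.sum_mem _ fun l _ => Submodule.smul_mem _ _ (hother l))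
    · exact hother j

/-- Existence of minimal free resolutions. -/
theorem exists_minimal_resolution [IsNoetherianRing R] (M : Type) [AddCommGroup M] [Module R M]
    [Module.Finite R M] :
    ∃ (b : ℕ → ℕ) (δ : ∀ i, Matrix (Fin (b i)) (Fin (b (i + 1))) R) (p : (Fin (b 0) → R) →ₗ[R] M),
      Function.Surjective p ∧ LinearMap.ker p = LinearMap.range (δ 0).mulVecLin ∧
      (∀ i, LinearMap.ker (δ i).mulVecLin = LinearMap.range (δ (i + 1)).mulVecLin) ∧
      ∀ i r s, δ i r s ∈ maximalIdeal R := by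
  classical
  obtain ⟨b₀, p, hp, hp'⟩ := exists_minimal_cover (R := R) M
  have hcover : ∀ S : Σ b : ℕ, Submodule R (Fin b → R), ∃ (b : ℕ) (g : (Fin b → R) →ₗ[R] S.2),
      Function.Surjective g ∧ ∀ x ∈ LinearMap.ker g, ∀ i, x i ∈ maximalIdeal R :=
    fun S => exists_minimal_cover S.2
  choose β g hg hg' using hcover
  let S : ℕ → Σ b : ℕ, Submodule R (Fin b → R) := fun n =>
    Nat.rec ⟨b₀, LinearMap.ker p⟩ (fun _ T => ⟨β T, LinearMap.ker (g T)⟩) n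
  have hS : ∀ n, ∀ x ∈ (S n).2, ∀ i, x i ∈ maximalIdeal R := fun n => by
    cases n with
    | zero => exact hp'
    | succ n => exact hg' (S n)
  let f : ∀ n, (Fin (S (n + 1)).1 → R) →ₗ[R] (Fin (S n).1 → R) := fun n =>
    (S n).2.subtype ∘ₗ g (S n)
  have hrange : ∀ n, LinearMap.range (f n) = (S n).2 := fun n => by
    rw [LinearMap.range_comp, LinearMap.range_eq_top.2 (hg (S n)), Submodule.map_top,
      Submodule.range_subtype]
  have hker : ∀ n, LinearMap.ker (f n) = (S (n + 1)).2 := fun n => by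
    rw [LinearMap.ker_comp, Submodule.ker_subtype]
    rfl
  have hlin : ∀ n, (LinearMap.toMatrix' (f n)).mulVecLin = f n := fun n => by
    rw [← Matrix.toLin'_apply', Matrix.toLin'_toMatrix']
  refine ⟨fun n => (S n).1, fun n => LinearMap.toMatrix' (f n), p, hp, ?_, fun n => ?_,
    fun n r s => ?_⟩
  · exact ((hlin 0).symm ▸ hrange 0).symm
  · rw [hlin n, hlin (n + 1), hker n]
    exact (hrange (n + 1)).symm
  · change LinearMap.toMatrix' (f n) r s ∈ _
    rw [LinearMap.toMatrix'_apply]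
    refine hS n _ ?_ r
    rw [← hrange n]
    exact ⟨_, rfl⟩

end MinimalResolution

section Betti

open Limits IsLocalRing

/-- An exact augmented complex of projectives is a projective resolution. -/
theorem ChainComplex.exists_projectiveResolution {C : Type*} [Category C] [Abelian C]
    (K : ChainComplex C ℕ) (Z : C) (hK : ∀ n, Projective (K.X n)) (p : K.X 0 ⟶ Z) [Epi p]
    (w : K.d 1 0 ≫ p = 0) (hp : (ShortComplex.mk _ _ w).Exact)
    (hex : ∀ n, K.ExactAt (n + 1)) : ∃ P : ProjectiveResolution Z, P.complex = K :=
  ⟨{complex := K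
    projective := hK
    π := (ChainComplex.toSingle₀Equiv _ _).symm ⟨p, w⟩
    quasiIso := ⟨fun n => by
      cases n
      · rw [ChainComplex.quasiIsoAt₀_iff, ShortComplex.quasiIso_iff_of_zeros']
        · refine (ShortComplex.exact_and_epi_g_iff_of_iso ?_).2
            ⟨hp, show Epi p from inferInstance⟩
          refine ShortComplex.isoMk (Iso.refl _) (Iso.refl _) (Iso.refl _)
            ((Category.id_comp _).trans (Category.comp_id _).symm) ?_
          simp only [Iso.refl_hom, HomologicalComplex.shortComplexFunctor'_map_τ₂,
            ChainComplex.toSingle₀Equiv_symm_apply_f_zero]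
          exact (Category.id_comp p).trans (Category.comp_id p).symm
        · exact K.shape _ _ (by simp)
        all_goals rfl
      · rw [quasiIsoAt_iff_exactAt']
        · apply hex
        · apply ChainComplex.exactAt_succ_single_obj⟩}, rfl⟩

/-- An exact complex of projectives resolves its zeroth homology. -/
theorem ChainComplex.exists_projectiveResolution_of_iso {C : Type*} [Category C] [Abelian C]
    (K : ChainComplex C ℕ) {Z : C} (e : K.homology 0 ≅ Z) (hK : ∀ n, Projective (K.X n))
    (hex : ∀ n, K.ExactAt (n + 1)) : ∃ P : ProjectiveResolution Z, P.complex = K :=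
  K.exists_projectiveResolution Z hK (K.pOpcycles 0 ≫ K.isoHomologyι₀.inv ≫ e.hom) (by simp)
    (ShortComplex.exact_of_g_is_cokernel _ (IsColimit.ofIsoColimit
      (K.opcyclesIsCokernel 1 0 (by simp))
      (Cofork.ext (K.isoHomologyι₀.symm ≪≫ e) (by simp))))
    hex

variable {R : Type} [CommRing R] {b : ℕ → ℕ}

/-- The complex of finite free modules given by a sequence of matrices. -/
noncomputable def matrixComplex (δ : ∀ i, Matrix (Fin (b i)) (Fin (b (i + 1))) R)
    (hδ : ∀ i, δ i * δ (i + 1) = 0) : ChainComplex (ModuleCat R) ℕ :=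
  ChainComplex.of (fun i => ModuleCat.of R (Fin (b i) → R))
    (fun i => ModuleCat.ofHom (δ i).mulVecLin) fun i => by
      rw [← ModuleCat.ofHom_comp, ← Matrix.mulVecLin_mul, hδ, Matrix.mulVecLin_zero]
      rfl

theorem matrixComplex_d (δ : ∀ i, Matrix (Fin (b i)) (Fin (b (i + 1))) R)
    (hδ : ∀ i, δ i * δ (i + 1) = 0) (i : ℕ) :
    (matrixComplex δ hδ).d (i + 1) i = ModuleCat.ofHom (δ i).mulVecLin :=
  ChainComplex.of_d (fun i => ModuleCat.of R (Fin (b i) → R))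
    (fun i => ModuleCat.ofHom (δ i).mulVecLin) i

theorem exactAt_matrixComplex {δ : ∀ i, Matrix (Fin (b i)) (Fin (b (i + 1))) R}
    (hδ : ∀ i, δ i * δ (i + 1) = 0) {i : ℕ}
    (h : LinearMap.ker (δ i).mulVecLin = LinearMap.range (δ (i + 1)).mulVecLin) :
    (matrixComplex δ hδ).ExactAt (i + 1) := by
  rw [HomologicalComplex.exactAt_iff' _ (i + 2) (i + 1) i (by simp) (by simp),
    ShortComplex.moduleCat_exact_iff]
  intro x hx
  change (matrixComplex δ hδ).d (i + 1) i x = 0 at hx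
  rw [matrixComplex_d] at hx
  have hx' : (x : Fin (b (i + 1)) → R) ∈ LinearMap.ker (δ i).mulVecLin := hx
  rw [h] at hx'
  obtain ⟨y, hy⟩ := hx'
  refine ⟨y, ?_⟩
  change (matrixComplex δ hδ).d (i + 1 + 1) (i + 1) y = x
  rw [matrixComplex_d]
  exact hy

theorem exists_projectiveResolution_matrixComplex {M : Type} [AddCommGroup M] [Module R M]
    {δ : ∀ i, Matrix (Fin (b i)) (Fin (b (i + 1))) R} (p : (Fin (b 0) → R) →ₗ[R] M)
    (hp : Function.Surjective p) (hpker : LinearMap.ker p = LinearMap.range (δ 0).mulVecLin)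
    (hex : ∀ i, LinearMap.ker (δ i).mulVecLin = LinearMap.range (δ (i + 1)).mulVecLin)
    (hδ : ∀ i, δ i * δ (i + 1) = 0) :
    ∃ P : ProjectiveResolution (ModuleCat.of R M), P.complex = matrixComplex δ hδ := by
  let p' : (matrixComplex δ hδ).X 0 ⟶ ModuleCat.of R M := ModuleCat.ofHom p
  have : Epi p' := (ModuleCat.epi_iff_surjective _).2 hp
  have hw : p ∘ₗ (δ 0).mulVecLin = 0 := LinearMap.range_le_ker_iff.1 hpker.ge
  have w : (matrixComplex δ hδ).d 1 0 ≫ p' = 0 := by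
    rw [matrixComplex_d]
    exact congrArg ModuleCat.ofHom hw
  refine (matrixComplex δ hδ).exists_projectiveResolution _
    (fun n => ModuleCat.projective_of_free (Pi.basisFun R (Fin (b n)))) p' w ?_
    (fun n => exactAt_matrixComplex hδ (hex n))
  rw [ShortComplex.moduleCat_exact_iff]
  intro x hx
  have hx' : (x : Fin (b 0) → R) ∈ LinearMap.ker p := hx
  rw [hpker] at hx'
  obtain ⟨y, hy⟩ := hx'
  refine ⟨y, ?_⟩
  change (matrixComplex δ hδ).d 1 0 y = x
  rw [matrixComplex_d]
  exact hy

variable [IsLocalRing R]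

theorem tmul_eq_zero_of_mem_maximalIdeal {A : Type*} [AddCommGroup A] [Module R A]
    (hA : ∀ r ∈ maximalIdeal R, ∀ a : A, r • a = 0) {ι : Type*} [Finite ι] (a : A) {x : ι → R}
    (hx : ∀ i, x i ∈ maximalIdeal R) : TensorProduct.tmul R a x = 0 := by
  classical
  have := Fintype.ofFinite ι
  rw [pi_eq_sum_univ x, TensorProduct.tmul_sum]
  refine Finset.sum_eq_zero fun i _ => ?_
  rw [← TensorProduct.smul_tmul, hA _ (hx i), TensorProduct.zero_tmul]

theorem finrank_extendScalars (f : R →+* ResidueField R) (n : ℕ) :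
    Module.finrank (ResidueField R)
      ((ModuleCat.extendScalars f).obj (ModuleCat.of R (Fin n → R))) = n := by
  let := f.toAlgebra
  exact (Module.finrank_baseChange (R := ResidueField R) (S := R) (M' := Fin n → R)).trans
    (Module.finrank_fin_fun R)

theorem finrank_homology_residueComplex_matrixComplex
    {δ : ∀ i, Matrix (Fin (b i)) (Fin (b (i + 1))) R} (hδ : ∀ i, δ i * δ (i + 1) = 0)
    (hmin : ∀ i r s, δ i r s ∈ maximalIdeal R) (n : ℕ) :
    Module.finrank (ResidueField R)
      ((((ModuleCat.extendScalars (residue R)).mapHomologicalComplex _).obj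
        (matrixComplex δ hδ)).homology n) = b n := by
  have hzero : ∀ i, (ModuleCat.extendScalars (residue R)).map
      ((matrixComplex δ hδ).d (i + 1) i) = 0 := fun i => by
    have hmem : ∀ (y : Fin (b (i + 1)) → R) (j : Fin (b i)), (δ i).mulVec y j ∈ maximalIdeal R :=
      fun y j => by
        rw [Matrix.mulVec, dotProduct]
        exact Ideal.sum_mem _ fun l _ => Ideal.mul_mem_right _ _ (hmin i j l)
    refine ModuleCat.hom_ext (LinearMap.ext fun z => ?_)
    change _ = 0
    refine TensorProduct.induction_on z (map_zero _) (fun c x => ?_) fun x y hx hy =>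
      (map_add _ x y).trans ((congrArg₂ _ hx hy).trans (add_zero _))
    refine (ModuleCat.ExtendScalars.map_tmul _ _ _ _).trans ?_
    rw [matrixComplex_d]
    let := Module.compHom (ResidueField R) (residue R)
    refine tmul_eq_zero_of_mem_maximalIdeal (A := ResidueField R) (ι := Fin (b i))
      (fun r hr a => ?_) c (hmem x)
    change residue R r * a = 0
    rw [(residue_eq_zero_iff r).2 hr, zero_mul]
  have hd : ∀ i j, ((((ModuleCat.extendScalars (residue R)).mapHomologicalComplex _).obj
        (matrixComplex δ hδ))).d i j = 0 := fun i j => by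
    by_cases h : j + 1 = i
    · subst h
      exact hzero j
    · exact HomologicalComplex.shape _ _ _ (by simpa using h)
  refine (LinearEquiv.finrank_eq (Iso.toLinearEquiv
    (ShortComplex.HomologyData.ofZeros
      ((((ModuleCat.extendScalars (residue R)).mapHomologicalComplex _).obj
        (matrixComplex δ hδ)).sc n) (hd _ _) (hd _ _)).left.homologyIso)).trans ?_
  exact finrank_extendScalars _ _

/-- The Betti numbers may be computed from a minimal resolution. -/
theorem finrank_homology_residueComplex {M : Type} [AddCommGroup M] [Module R M]
    {δ : ∀ i, Matrix (Fin (b i)) (Fin (b (i + 1))) R} (p : (Fin (b 0) → R) →ₗ[R] M)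
    (hp : Function.Surjective p) (hpker : LinearMap.ker p = LinearMap.range (δ 0).mulVecLin)
    (hex : ∀ i, LinearMap.ker (δ i).mulVecLin = LinearMap.range (δ (i + 1)).mulVecLin)
    (hmin : ∀ i r s, δ i r s ∈ maximalIdeal R) (P : ChainComplex (ModuleCat R) ℕ)
    (hfree : ∀ j, Module.Free R (P.X j))
    (hres0 : Nonempty (P.homology 0 ≅ ModuleCat.of R M))
    (hres : ∀ i, 0 < i → Subsingleton (P.homology i)) (n : ℕ) :
    Module.finrank (ResidueField R)
      ((((ModuleCat.extendScalars (residue R)).mapHomologicalComplex _).obj P).homology n) = b n := by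
  have hδ : ∀ i, δ i * δ (i + 1) = 0 := fun i => by
    apply Matrix.toLin'.injective
    rw [Matrix.toLin'_mul, map_zero]
    exact LinearMap.range_le_ker_iff.1 (hex i).ge
  have hP : ∃ P' : ProjectiveResolution (ModuleCat.of R M), P'.complex = P := by
    refine P.exists_projectiveResolution_of_iso hres0.some (fun j => ?_) fun j => ?_
    · have := hfree j
      exact ModuleCat.projective_of_free (Module.Free.chooseBasis R (P.X j))
    · rw [HomologicalComplex.exactAt_iff_isZero_homology]
      have := hres (j + 1) j.succ_pos
      exact ModuleCat.isZero_of_subsingleton _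
  obtain ⟨P', rfl⟩ := hP
  obtain ⟨Q, hQ⟩ := exists_projectiveResolution_matrixComplex p hp hpker hex hδ
  rw [← finrank_homology_residueComplex_matrixComplex hδ hmin, ← hQ]
  have : (ModuleCat.extendScalars (residue R)).Additive :=
    (ModuleCat.extendRestrictScalarsAdj (residue R)).left_adjoint_additive
  exact LinearEquiv.finrank_eq (Iso.toLinearEquiv
    ((P'.isoLeftDerivedObj _ n).symm ≪≫ Q.isoLeftDerivedObj _ n))

end Betti

section FrobeniusTwist

open IsLocalRing

theorem IsFiniteLength.exists_pow_smul_eq_zero {R M : Type*} [CommRing R] [IsLocalRing R]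
    [AddCommGroup M] [Module R M] (h : IsFiniteLength R M) :
    ∃ n, ∀ c ∈ maximalIdeal R ^ n, ∀ x : M, c • x = 0 := by
  induction h with
  | of_subsingleton => exact ⟨0, fun c _ x => Subsingleton.elim _ _⟩
  | @of_simple_quotient M _ _ N _ _ ih =>
    obtain ⟨n, hn⟩ := ih
    have hmax : maximalIdeal R ≤ Module.annihilator R (M ⧸ N) :=
      (eq_maximalIdeal IsSimpleModule.annihilator_isMaximal).ge
    refine ⟨n + 1, fun c hc => ?_⟩
    rw [pow_succ] at hc
    refine Submodule.mul_induction_on hc (fun r hr s hs x => ?_) fun r s hr hs x => by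
      rw [add_smul, hr, hs, add_zero]
    have hsx : s • x ∈ N := by
      rw [← Submodule.Quotient.mk_eq_zero, Submodule.Quotient.mk_smul]
      exact Module.mem_annihilator.1 (hmax hs) _
    rw [mul_smul]
    exact congrArg Subtype.val (hn r hr ⟨s • x, hsx⟩)

theorem Matrix.exists_mul_eq_of_forall_mem_range {R l m n : Type*} [CommRing R] [Fintype m]
    [Fintype n] [DecidableEq n] {D : Matrix l m R} {A : Matrix l n R}
    (h : ∀ x, A.mulVec x ∈ LinearMap.range D.mulVecLin) : ∃ X : Matrix m n R, D * X = A := by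
  choose y hy using h
  refine ⟨Matrix.of fun i j => y (Pi.single j 1) i, Matrix.ext fun i j => ?_⟩
  have := congrFun (hy (Pi.single j 1)) i
  rw [Matrix.mulVec_single_one] at this
  exact this

variable {R : Type*} [CommRing R] {b : ℕ → ℕ}

theorem exists_homotopy_succ {δ : ∀ i, Matrix (Fin (b i)) (Fin (b (i + 1))) R} {i : ℕ}
    (hex : LinearMap.ker (δ i).mulVecLin = LinearMap.range (δ (i + 1)).mulVecLin)
    {c : R} {η : Matrix (Fin (b (i + 1))) (Fin (b i)) R} (hη : δ i * η * δ i = c • δ i) :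
    ∃ η' : Matrix (Fin (b (i + 2))) (Fin (b (i + 1))) R, δ (i + 1) * η' + η * δ i = c • 1 := by
  obtain ⟨η', hη'⟩ := Matrix.exists_mul_eq_of_forall_mem_range (D := δ (i + 1))
    (A := c • (1 : Matrix (Fin (b (i + 1))) (Fin (b (i + 1))) R) - η * δ i) fun x => by
      rw [← hex, LinearMap.mem_ker, Matrix.mulVecLin_apply, Matrix.mulVec_mulVec, Matrix.mul_sub,
        ← Matrix.mul_assoc, hη]
      simp
  exact ⟨η', by rw [hη', sub_add_cancel]⟩

/-- Multiplication by `c` is null-homotopic in positive degrees. -/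
theorem exists_homotopy {δ : ∀ i, Matrix (Fin (b i)) (Fin (b (i + 1))) R}
    (hex : ∀ i, LinearMap.ker (δ i).mulVecLin = LinearMap.range (δ (i + 1)).mulVecLin)
    (hδ : ∀ i, δ i * δ (i + 1) = 0)
    {c : R} (hc : ∀ x, c • x ∈ LinearMap.range (δ 0).mulVecLin) (i : ℕ) :
    ∃ (η : Matrix (Fin (b (i + 1))) (Fin (b i)) R)
      (η' : Matrix (Fin (b (i + 2))) (Fin (b (i + 1))) R), δ (i + 1) * η' + η * δ i = c • 1 := by
  suffices ∃ η : Matrix (Fin (b (i + 1))) (Fin (b i)) R, δ i * η * δ i = c • δ i by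
    obtain ⟨η, hη⟩ := this
    exact ⟨η, exists_homotopy_succ (hex i) hη⟩
  induction i with
  | zero =>
    obtain ⟨η, hη⟩ := Matrix.exists_mul_eq_of_forall_mem_range (D := δ 0)
      (A := c • (1 : Matrix (Fin (b 0)) (Fin (b 0)) R)) fun x => by
        simpa [Matrix.smul_mulVec] using hc x
    exact ⟨η, by rw [hη]; simp⟩
  | succ i ih =>
    obtain ⟨η, hη⟩ := ih
    obtain ⟨η', hη'⟩ := exists_homotopy_succ (hex i) hη
    refine ⟨η', ?_⟩
    rw [eq_sub_of_add_eq hη', Matrix.sub_mul, Matrix.mul_assoc, hδ]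
    simp

theorem map_smul_mem_range {δ : ∀ i, Matrix (Fin (b i)) (Fin (b (i + 1))) R}
    (hex : ∀ i, LinearMap.ker (δ i).mulVecLin = LinearMap.range (δ (i + 1)).mulVecLin)
    (hδ : ∀ i, δ i * δ (i + 1) = 0)
    {c : R} (hc : ∀ x, c • x ∈ LinearMap.range (δ 0).mulVecLin) (φ : R →+* R) (i : ℕ)
    {z : Fin (b (i + 1)) → R} (hz : z ∈ LinearMap.ker ((δ i).map φ).mulVecLin) :
    φ c • z ∈ LinearMap.range ((δ (i + 1)).map φ).mulVecLin := by
  obtain ⟨η, η', h⟩ := exists_homotopy hex hδ hc i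
  have h' : (δ (i + 1)).map φ * η'.map φ + η.map φ * (δ i).map φ =
      φ c • (1 : Matrix (Fin (b (i + 1))) (Fin (b (i + 1))) R) := by
    rw [← Matrix.map_mul, ← Matrix.map_mul, ← Matrix.map_add φ (map_add φ), h,
      Matrix.map_smul' _ _ _ (map_mul φ), Matrix.map_one φ (map_zero φ) (map_one φ)]
  refine ⟨(η'.map φ).mulVec z, ?_⟩
  have hz' : ((δ i).map φ).mulVec z = 0 := hz
  have := congrArg (fun A => Matrix.mulVec A z) h'
  simpa [Matrix.add_mulVec, ← Matrix.mulVec_mulVec, hz', Matrix.smul_mulVec] using this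

/-- The homology of a Frobenius twist of a resolution of a module of finite length is torsion. -/
theorem exists_pow_smul_mem_range [IsLocalRing R] [IsNoetherianRing R] {p : ℕ} [ExpChar R p]
    {δ : ∀ i, Matrix (Fin (b i)) (Fin (b (i + 1))) R}
    (hex : ∀ i, LinearMap.ker (δ i).mulVecLin = LinearMap.range (δ (i + 1)).mulVecLin)
    (hδ : ∀ i, δ i * δ (i + 1) = 0)
    {n : ℕ} (hn : ∀ c ∈ maximalIdeal R ^ n, ∀ x, c • x ∈ LinearMap.range (δ 0).mulVecLin)
    (e i : ℕ) :
    ∃ N, ∀ c ∈ maximalIdeal R ^ N,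
      ∀ z ∈ LinearMap.ker ((δ i).map (iterateFrobenius R p e)).mulVecLin,
        c • z ∈ LinearMap.range ((δ (i + 1)).map (iterateFrobenius R p e)).mulVecLin := by
  let I : Ideal R := (LinearMap.range ((δ (i + 1)).map (iterateFrobenius R p e)).mulVecLin).colon
    (LinearMap.ker ((δ i).map (iterateFrobenius R p e)).mulVecLin)
  obtain ⟨N, hN⟩ := Ideal.exists_pow_le_of_le_radical_of_fg (I := maximalIdeal R ^ n) (J := I)
    (fun c hc => ⟨p ^ e, Submodule.mem_colon.2 fun z hz => by
      rw [← iterateFrobenius_def]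
      exact map_smul_mem_range hex hδ (hn c hc) _ i hz⟩) (IsNoetherian.noetherian _)
  rw [← pow_mul] at hN
  exact ⟨_, fun c hc => Submodule.mem_colon.1 (hN hc)⟩

end FrobeniusTwist

section TotalMatrix

variable {R : Type*} [CommRing R] {b : ℕ → ℕ}

/-- The differential of a complex of free modules, as a single square matrix. -/
def totalMatrix (δ : ∀ i, Matrix (Fin (b i)) (Fin (b (i + 1))) R) :
    Matrix (Σ i, Fin (b i)) (Σ i, Fin (b i)) R := fun x y =>
  if h : y.1 = x.1 + 1 then δ x.1 x.2 (Fin.cast (congrArg b h) y.2) else 0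

variable (δ : ∀ i, Matrix (Fin (b i)) (Fin (b (i + 1))) R)

theorem totalMatrix_apply_succ (i : ℕ) (r : Fin (b i)) (s : Fin (b (i + 1))) :
    totalMatrix δ ⟨i, r⟩ ⟨i + 1, s⟩ = δ i r s :=
  dif_pos rfl

theorem lowersDegree_totalMatrix : LowersDegree Sigma.fst (totalMatrix δ) := fun x y h => by
  by_contra h'
  exact h (dif_neg h')

theorem totalMatrix_map (φ : R →+* R) :
    (totalMatrix δ).map φ = totalMatrix fun i => (δ i).map φ := by
  ext x y
  by_cases h : y.1 = x.1 + 1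
  · simp [totalMatrix, h]
  · simp [totalMatrix, h]

variable [Fintype (Σ i, Fin (b i))]

theorem totalMatrix_mulVec (x : (Σ i, Fin (b i)) → R) (i : ℕ) (r : Fin (b i)) :
    (totalMatrix δ).mulVec x ⟨i, r⟩ = (δ i).mulVec (fun s => x ⟨i + 1, s⟩) r := by
  refine (Fintype.sum_of_injective (fun s : Fin (b (i + 1)) => (⟨i + 1, s⟩ : Σ i, Fin (b i)))
    (fun s t h => by simpa using h) _ _ (fun y hy => ?_) fun s => ?_).symm
  · change totalMatrix δ ⟨i, r⟩ y * x y = 0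
    rw [(lowersDegree_totalMatrix δ).eq_zero, zero_mul]
    rintro h
    obtain ⟨j, s⟩ := y
    obtain rfl : j = i + 1 := h
    exact hy ⟨s, rfl⟩
  · simp only [totalMatrix_apply_succ]

variable {δ}

theorem totalMatrix_mul_self (hδ : ∀ i, δ i * δ (i + 1) = 0) :
    totalMatrix δ * totalMatrix δ = 0 := by
  refine Matrix.toLin'.injective (LinearMap.ext fun x => funext fun ⟨i, r⟩ => ?_)
  rw [Matrix.toLin'_apply, ← Matrix.mulVec_mulVec, totalMatrix_mulVec]
  simp only [totalMatrix_mulVec]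
  change (δ i).mulVec ((δ (i + 1)).mulVec _) r = _
  rw [Matrix.mulVec_mulVec, hδ]
  simp

theorem acyclicPos_totalMatrix
    (h : ∀ i, LinearMap.ker (δ i).mulVecLin = LinearMap.range (δ (i + 1)).mulVecLin) :
    AcyclicPos Sigma.fst (totalMatrix δ) := fun x hx hx0 => by
  have hmem : ∀ i, ∃ y, (δ (i + 1)).mulVec y = fun s => x ⟨i + 1, s⟩ := fun i => by
    have : (fun s => x ⟨i + 1, s⟩) ∈ LinearMap.ker (δ i).mulVecLin := funext fun r =>
      (totalMatrix_mulVec δ x i r).symm.trans (congrFun hx _)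
    rwa [h i] at this
  choose y hy using hmem
  let z : ∀ i, Fin (b i) → R := fun i => match i with
    | 0 => 0
    | 1 => 0
    | i + 2 => y i
  refine ⟨fun q => z q.1 q.2, funext fun ⟨i, r⟩ => ?_⟩
  rw [totalMatrix_mulVec]
  cases i with
  | zero =>
    rw [hx0 _ rfl]
    exact congrFun (Matrix.mulVec_zero (δ 0)) r
  | succ i => exact congrFun (hy i) r

theorem mem_boundaryZero_totalMatrix {x : (Σ i, Fin (b i)) → R}
    (hx : (fun r => x ⟨0, r⟩) ∈ LinearMap.range (δ 0).mulVecLin) :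
    x ∈ boundaryZero Sigma.fst (totalMatrix δ) := by
  obtain ⟨y, hy⟩ := hx
  let z : ∀ i, Fin (b i) → R := fun i => match i with
    | 0 => 0
    | 1 => y
    | _ + 2 => 0
  refine ⟨fun q => z q.1 q.2, ?_⟩
  rintro ⟨i, r⟩ (rfl : i = 0)
  rw [totalMatrix_mulVec]
  exact congrFun hy r

end TotalMatrix

section BettiBound

open IsLocalRing

theorem length_iterateFrobenius_le {R ι : Type*} [CommRing R] [CharP R 2] [ExpChar R 2] [Fintype ι]
    {deg : ι → ℕ} {D : Matrix ι ι R} (hdeg : LowersDegree deg D) (hD : D * D = 0)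
    (hac : ∀ e, AcyclicPos deg (D.map (iterateFrobenius R 2 e))) (e : ℕ) :
    Module.length R ((ι → R) ⧸ boundaryZero deg (D.map (iterateFrobenius R 2 e))) ≤
      (Fintype.card ι ^ e : ℕ) * Module.length R ((ι → R) ⧸ boundaryZero deg D) := by
  have hpow : ∀ e, D.map (iterateFrobenius R 2 e) = D.map (· ^ 2 ^ e) := fun e => by
    ext i j
    simp [iterateFrobenius_def]
  induction e with
  | zero =>
    have h0 : D.map (iterateFrobenius R 2 0) = D := by
      rw [hpow]
      ext i j
      simp
    rw [h0]
    simp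
  | succ e ih =>
    have hsucc : D.map (iterateFrobenius R 2 (e + 1)) =
        (D.map (iterateFrobenius R 2 e)).map (· ^ 2) := by
      ext i j
      simp [iterateFrobenius_def, pow_succ, pow_mul]
    have hdeg' : LowersDegree deg (D.map (iterateFrobenius R 2 e)) := by
      rw [hpow]
      exact hdeg.map (by positivity)
    have hD' : D.map (iterateFrobenius R 2 e) * D.map (iterateFrobenius R 2 e) = 0 := by
      rw [← Matrix.map_mul, hD, Matrix.map_zero _ (map_zero _)]
    have h2 := hac (e + 1)
    rw [hsucc] at h2 ⊢
    refine (length_frobenius_le hdeg' hD' (hac e) h2).trans ?_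
    rw [pow_succ', Nat.cast_mul, mul_assoc]
    gcongr

theorem length_quotient_le_length_quotient_boundaryZero {R ι : Type*} [CommRing R] [Fintype ι]
    {deg : ι → ℕ} {D : Matrix ι ι R} {J : Ideal R} (hJ : ∀ i j, D i j ∈ J) {i : ι}
    (hi : deg i = 0) :
    Module.length R (R ⧸ J) ≤ Module.length R ((ι → R) ⧸ boundaryZero deg D) := by
  refine Module.length_le_of_ker_le (boundaryZero deg D).mkQ (J.mkQ ∘ₗ LinearMap.proj i)
    (J.mkQ_surjective.comp (LinearMap.proj_surjective i)) ?_
  rw [Submodule.ker_mkQ]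
  rintro x ⟨y, hy⟩
  rw [LinearMap.mem_ker, LinearMap.comp_apply, Submodule.mkQ_apply, Submodule.Quotient.mk_eq_zero,
    LinearMap.proj_apply, ← hy i hi]
  exact Ideal.sum_mem _ fun j _ => Ideal.mul_mem_right _ _ (hJ i j)

theorem Nat.le_of_forall_pow_le_mul_pow {a β C : ℕ} (hβ : 0 < β) (h : ∀ e, a ^ e ≤ C * β ^ e) :
    a ≤ β := by
  by_contra! hlt
  have hβ' : (0 : ℝ) < β := by exact_mod_cast hβ
  obtain ⟨e, he⟩ := pow_unbounded_of_one_lt (C : ℝ)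
    ((one_lt_div hβ').2 (by exact_mod_cast hlt : (β : ℝ) < a))
  rw [div_pow, lt_div_iff₀ (by positivity)] at he
  have := h e
  have : (a : ℝ) ^ e ≤ C * β ^ e := by exact_mod_cast this
  linarith

variable {R : Type} [CommRing R] [IsNoetherianRing R] [IsLocalRing R] {b : ℕ → ℕ}
  {δ : ∀ i, Matrix (Fin (b i)) (Fin (b (i + 1))) R}

/-- Frobenius twists of a finite minimal free resolution of a module of finite length are exact. -/
theorem ker_iterateFrobenius_eq_range [ExpChar R 2]
    (hmin : ∀ i r s, δ i r s ∈ maximalIdeal R)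
    (hex : ∀ i, LinearMap.ker (δ i).mulVecLin = LinearMap.range (δ (i + 1)).mulVecLin)
    (hδ : ∀ i, δ i * δ (i + 1) = 0) (hb : b 0 ≠ 0) {n : ℕ} (hn : ∀ i, n < i → b i = 0) {N : ℕ}
    (hN : ∀ c ∈ maximalIdeal R ^ N, ∀ x, c • x ∈ LinearMap.range (δ 0).mulVecLin) (e i : ℕ) :
    LinearMap.ker ((δ i).map (iterateFrobenius R 2 e)).mulVecLin =
      LinearMap.range ((δ (i + 1)).map (iterateFrobenius R 2 e)).mulVecLin := by
  have hs0 : b (Nat.findGreatest (fun i => b i ≠ 0) n) ≠ 0 :=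
    Nat.findGreatest_spec (P := fun i => b i ≠ 0) (Nat.zero_le n) hb
  have hs : ∀ i, Nat.findGreatest (fun i => b i ≠ 0) n < i → b i = 0 := fun i hi => by
    by_contra h
    rcases le_or_gt i n with hin | hin
    · exact Nat.findGreatest_is_greatest hi hin h
    · exact h (hn i hin)
  exact ker_le_range_of_residueExt (fun i => (δ i).map (iterateFrobenius R 2 e)) hs
    (subsingleton_residueExt_of_minimal δ hmin hex hs0 (hs _ (Nat.lt_succ_self _)))
    (fun i => by rw [← Matrix.map_mul, hδ, Matrix.map_zero _ (map_zero _)])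
    (exists_pow_smul_mem_range hex hδ hN e) i

/-- The total rank of a finite minimal free resolution of a nonzero module of finite length. -/
theorem two_pow_le_sum_of_minimal_resolution [CharP R 2] {d : ℕ} (hdim : ringKrullDim R = d)
    {M : Type} [AddCommGroup M] [Module R M] [Nontrivial M] (hlen : IsFiniteLength R M)
    (p : (Fin (b 0) → R) →ₗ[R] M) (hp : Function.Surjective p)
    (hpker : LinearMap.ker p = LinearMap.range (δ 0).mulVecLin)
    (hmin : ∀ i r s, δ i r s ∈ maximalIdeal R)
    (hex : ∀ i, LinearMap.ker (δ i).mulVecLin = LinearMap.range (δ (i + 1)).mulVecLin)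
    {n : ℕ} (hn : ∀ i, n < i → b i = 0) :
    2 ^ d ≤ ∑ i ∈ Finset.range (n + 1), b i := by
  have : ExpChar R 2 := .prime Nat.prime_two
  have hδ : ∀ i, δ i * δ (i + 1) = 0 := fun i => by
    apply Matrix.toLin'.injective
    rw [Matrix.toLin'_mul, map_zero]
    exact LinearMap.range_le_ker_iff.1 (hex i).ge
  have hb : b 0 ≠ 0 := fun h => by
    have : IsEmpty (Fin (b 0)) := by rw [h]; infer_instance
    exact not_subsingleton M hp.subsingleton
  obtain ⟨N, hN⟩ := hlen.exists_pow_smul_eq_zero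
  have hN' : ∀ c ∈ maximalIdeal R ^ N, ∀ x, c • x ∈ LinearMap.range (δ 0).mulVecLin :=
    fun c hc x => by rw [← hpker, LinearMap.mem_ker, map_smul, hN c hc]
  have hexF := ker_iterateFrobenius_eq_range hmin hex hδ hb hn hN'
  let hι : Fintype (Σ i, Fin (b i)) := ⟨(Finset.range (n + 1)).sigma fun _ => Finset.univ,
    fun ⟨i, r⟩ => by
      simp only [Finset.mem_sigma, Finset.mem_range, Finset.mem_univ, and_true]
      by_contra h
      exact (hn i (by omega) ▸ r).elim0⟩
  have hcard : Fintype.card (Σ i, Fin (b i)) = ∑ i ∈ Finset.range (n + 1), b i :=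
    (Finset.card_sigma _ _).trans (by simp)
  rw [← hcard]
  set β := Fintype.card (Σ i, Fin (b i))
  set D := totalMatrix δ
  obtain ⟨C, hC⟩ := exists_pow_le_length_of_ringKrullDim hdim
  have hfin : Module.length R (((Σ i, Fin (b i)) → R) ⧸ boundaryZero Sigma.fst D) ≠ ⊤ := by
    refine ne_top_of_le_ne_top (Module.length_ne_top_iff.2 hlen) (Module.length_le_of_ker_le
      (p ∘ₗ LinearMap.funLeft R R fun r => (⟨0, r⟩ : Σ i, Fin (b i))) _
      (Submodule.mkQ_surjective _) fun x hx => ?_)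
    rw [Submodule.ker_mkQ]
    exact mem_boundaryZero_totalMatrix (hpker ▸ hx)
  obtain ⟨ℓ, hℓ⟩ := ENat.ne_top_iff_exists.1 hfin
  have i₀ : Fin (b 0) := ⟨0, Nat.pos_of_ne_zero hb⟩
  refine Nat.le_of_forall_pow_le_mul_pow (C := C * ℓ)
    (Fintype.card_pos_iff.2 ⟨⟨0, i₀⟩⟩) fun e => ?_
  have hmem : ∀ x y, D.map (iterateFrobenius R 2 e) x y ∈ maximalIdeal R ^ 2 ^ e := fun x y => by
    rw [Matrix.map_apply, iterateFrobenius_def]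
    refine Ideal.pow_mem_pow ?_ _
    by_cases h : y.1 = x.1 + 1
    · simp only [D, totalMatrix, h, dif_pos, hmin]
    · simp only [D, totalMatrix, h, dif_neg, not_false_eq_true, zero_mem]
  have hlower := length_quotient_le_length_quotient_boundaryZero (deg := Sigma.fst) hmem
    (i := ⟨0, i₀⟩) rfl
  have hupper := length_iterateFrobenius_le (lowersDegree_totalMatrix δ)
    (totalMatrix_mul_self hδ) (fun e => by
      rw [totalMatrix_map]
      exact acyclicPos_totalMatrix (hexF e)) e
  have key : (((2 ^ e) ^ d : ℕ) : ℕ∞) ≤ (C * ℓ * β ^ e : ℕ) :=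
    calc (((2 ^ e) ^ d : ℕ) : ℕ∞) ≤ C * Module.length R (R ⧸ maximalIdeal R ^ 2 ^ e) :=
          hC _ (by positivity)
      _ ≤ C * ((β ^ e : ℕ) * ℓ) := by
          rw [hℓ]
          gcongr
          exact hlower.trans hupper
      _ = (C * ℓ * β ^ e : ℕ) := by
          push_cast
          ring
  rw [← pow_mul, mul_comm, pow_mul]
  exact_mod_cast key

end BettiBound

/-- Let `(R, m, k)` be a Noetherian local ring of characteristic `2` and
Krull dimension `d`, and let `M` be a nonzero `R`-module of finite length and finite
projective dimension (the latter being witnessed by a finite free resolution `P` of `M`,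
concentrated in degrees `0, …, n`).  Then the total Betti number
`β(M) = ∑_i dim_k Tor_i^R(M, k) = ∑_i dim_k H_i(P ⊗_R k)` is at least `2^d`. -/
theorem stmt1 (R : Type) [CommRing R] [IsNoetherianRing R] [IsLocalRing R] [CharP R 2]
    (d : ℕ) (hdim : ringKrullDim R = d)
    (M : Type) [AddCommGroup M] [Module R M] [Nontrivial M]
    (hlen : IsFiniteLength R M)
    -- `P` is a finite free resolution of `M`, concentrated in degrees `0, …, n`;
    -- its existence is the assertion that `M` has finite projective dimension
    (P : ChainComplex (ModuleCat R) ℕ) (n : ℕ)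
    (hfree : ∀ j, Module.Free R (P.X j))
    (hfin : ∀ j, Module.Finite R (P.X j))
    (hbdd : ∀ j, n < j → Subsingleton (P.X j))
    (hres0 : Nonempty (P.homology 0 ≅ ModuleCat.of R M))
    (hres : ∀ i, 0 < i → Subsingleton (P.homology i)) :
    2 ^ d ≤ ∑ i ∈ Finset.range (n + 1),
      Module.finrank (IsLocalRing.ResidueField R) ((residueComplex R P).homology i) := by
  have : IsNoetherian R M := (isFiniteLength_iff_isNoetherian_isArtinian.1 hlen).1
  obtain ⟨b, δ, p, hp, hpker, hex, hmin⟩ := exists_minimal_resolution (R := R) M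
  have hbetti : ∀ i, Module.finrank (IsLocalRing.ResidueField R)
      ((residueComplex R P).homology i) = b i :=
    finrank_homology_residueComplex p hp hpker hex hmin P hfree hres0 hres
  have hb : ∀ i, n < i → b i = 0 := fun i hi => by
    have := hbdd i hi
    have hexact : (residueComplex R P).ExactAt i :=
      ShortComplex.exact_of_isZero_X₂ _
        ((ModuleCat.extendScalars (IsLocalRing.residue R)).map_isZero
          (ModuleCat.isZero_of_subsingleton (P.X i)))
    have := ModuleCat.subsingleton_of_isZero hexact.isZero_homology
    rw [← hbetti i, Module.finrank_zero_of_subsingleton]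
  simp only [hbetti]
  exact two_pow_le_sum_of_minimal_resolution hdim hlen p hp hpker hmin hex hb
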